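/- arXiv:2409.17305 — 4 statements merged into one kernel-verified Lean document; each statement's English description precedes it below -/
import Mathlib

section
/- Let η ≠ 0 and ℓ > −3/2 with ℓ ≠ −1. Define the polynomials p_n(x) = (2x)^n R_{n,ℓ,η}(1/(2x)) (the reversed polynomial, a polynomial of degree at most n in x). Then p_n converges to φ_{ℓ,η} uniformly on every compact subset of ℂ; in particular, (2x)^n R_{n,ℓ,η}(1/(2x)) → φ_{ℓ,η}(x) as n → ∞ for every x ∈ ℂ. -/
open Polynomial

/-- The recurrence coefficient α_n = −η/(2(ℓ+n+1)(ℓ+n+2)). -/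
noncomputable def alphaR (l η : ℝ) (n : ℕ) : ℝ :=
  -η / (2 * (l + n + 1) * (l + n + 2))

/-- The recurrence coefficient
β_n = ((ℓ+n+1)² + η²)/(2(2ℓ+2n+1)(2ℓ+2n+2)(2ℓ+2n+3)(ℓ+n+1)). -/
noncomputable def betaR (l η : ℝ) (n : ℕ) : ℝ :=
  ((l + n + 1) ^ 2 + η ^ 2) /
    (2 * (2 * l + 2 * n + 1) * (2 * l + 2 * n + 2) * (2 * l + 2 * n + 3) * (l + n + 1))

/-- The monic orthogonal polynomials R_{n,ℓ,η} of Wimp, defined by the three-term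
recurrence R_{n+1} = (X − α_n) R_n − β_n R_{n−1}, with R_0 = 1 and
R_1 = X + η/(2(ℓ+1)(ℓ+2)). -/
noncomputable def Rpoly (l η : ℝ) : ℕ → Polynomial ℝ
  | 0 => 1
  | 1 => X + C (η / (2 * (l + 1) * (l + 2)))
  | (n + 2) =>
      (X - C (alphaR l η (n + 1))) * Rpoly l η (n + 1) - C (betaR l η (n + 1)) * Rpoly l η n

noncomputable def coulombCoeff (l η : ℝ) : ℕ → ℝ
  | 0 => 1
  | 1 => η / (l + 1)
  | (k + 2) =>
      (2 * η * coulombCoeff l η (k + 1) - coulombCoeff l η k) /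
        (((k : ℝ) + 2) * (((k : ℝ) + 2) + 2 * l + 1))

/-- The entire function φ_{ℓ,η} on ℂ. -/
noncomputable def coulombPhiC (l η : ℝ) (z : ℂ) : ℂ :=
  ∑' k : ℕ, (coulombCoeff l η k : ℂ) * z ^ k

/-- The reversed polynomial p_n(x) = (2x)^n R_{n,ℓ,η}(1/(2x)), as a polynomial function
of x ∈ ℂ (namely x ↦ (reflect n R_{n,ℓ,η})(2x)). -/
noncomputable def reversedR (l η : ℝ) (n : ℕ) (z : ℂ) : ℂ :=
  aeval (2 * z) (reflect n (Rpoly l η n))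

/-- The increment `e_n` for which `∏ (1 + e_j)` bounds the reversed polynomials on the disc of
radius `r`. -/
noncomputable def reversedBoundTerm (l η r : ℝ) (n : ℕ) : ℝ :=
  2 * r * |alphaR l η n| + 4 * r ^ 2 * |betaR l η n|

lemma coulombCoeff_rec {l : ℝ} (η : ℝ) (hl : -3/2 < l) (k : ℕ) :
    ((k : ℝ) + 2) * (k + 2 * l + 3) * coulombCoeff l η (k + 2) =
      2 * η * coulombCoeff l η (k + 1) - coulombCoeff l η k := by
  have hk : (0 : ℝ) ≤ k := k.cast_nonneg
  have h1 : (k : ℝ) + 2 ≠ 0 := by positivity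
  have h2 : (k : ℝ) + 2 + 2 * l + 1 ≠ 0 := by linarith
  rw [coulombCoeff]
  field_simp
  ring

lemma coulombCoeff_zero (l η : ℝ) : coulombCoeff l η 0 = 1 := by rw [coulombCoeff]

lemma coulombCoeff_one (l η : ℝ) : coulombCoeff l η 1 = η / (l + 1) := by rw [coulombCoeff]

lemma coulombCoeff_lower {l : ℝ} (η : ℝ) (hl : -3/2 < l) (hl1 : l ≠ -1) (k : ℕ) :
    (2 * l + 3) * coulombCoeff l η (k + 1) =
      (k + 2 * l + 4) * coulombCoeff (l + 1) η (k + 1) +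
        η / (l + 1) * coulombCoeff (l + 1) η k := by
  have e1 : l + 1 ≠ 0 := fun h => hl1 (by linarith)
  have e2 : l + 1 + 1 ≠ 0 := by linarith
  have hl' : -3/2 < l + 1 := by linarith
  induction k using Nat.strong_induction_on with
  | _ k ih =>
    match k with
    | 0 =>
      simp only [zero_add, coulombCoeff_zero, coulombCoeff_one, Nat.cast_zero]
      field_simp
      ring
    | 1 =>
      have h0 := coulombCoeff_rec η hl 0
      have h1 := coulombCoeff_rec η hl' 0
      simp only [zero_add, coulombCoeff_zero, coulombCoeff_one, Nat.cast_zero, Nat.cast_one,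
        Nat.reduceAdd] at *
      have hx : coulombCoeff l η 2 = (2 * η * (η / (l + 1)) - 1) / (2 * (2 * l + 3)) := by
        rw [eq_div_iff (by linarith)]; linarith
      have hy : coulombCoeff (l + 1) η 2 =
          (2 * η * (η / (l + 1 + 1)) - 1) / (2 * (2 * (l + 1) + 3)) := by
        rw [eq_div_iff (by linarith)]; linarith
      have e3 : 2 * l + 3 ≠ 0 := by linarith
      have e4 : 2 * (l + 1) + 3 ≠ 0 := by linarith
      rw [hx, hy]
      field_simp
      ring
    | k + 2 =>
      have i1 := ih (k + 1) (by omega)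
      have i0 := ih k (by omega)
      have r := coulombCoeff_rec η hl (k + 1)
      have r1 := coulombCoeff_rec η hl' (k + 1)
      have r0 := coulombCoeff_rec η hl' k
      have hk : (0 : ℝ) ≤ k := k.cast_nonneg
      have hη : η = η / (l + 1) * (l + 1) := by field_simp
      generalize η / (l + 1) = t at *
      push_cast at *
      have hne : ((k : ℝ) + 1 + 2) * (k + 1 + 2 * l + 3) ≠ 0 :=
        mul_ne_zero (by linarith) (by linarith)
      apply mul_left_cancel₀ hne
      simp only [add_assoc, Nat.reduceAdd] at *
      generalize coulombCoeff l η (k + 3) = b3 at *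
      generalize coulombCoeff (l + 1) η (k + 3) = a3 at *
      generalize coulombCoeff l η (k + 2) = b2 at *
      generalize coulombCoeff (l + 1) η (k + 2) = a2 at *
      generalize coulombCoeff l η (k + 1) = b1 at *
      generalize coulombCoeff (l + 1) η (k + 1) = a1 at *
      generalize coulombCoeff (l + 1) η k = a0 at *
      generalize (k : ℝ) = x at *
      linear_combination (2 * l + 3) * r + 2 * η * i1 - i0 - (x + 1 + 2 * l + 3) * r1 - t * r0
        + 2 * a2 * hη

lemma coulombCoeff_contiguous {l : ℝ} (η : ℝ) (hl : -3/2 < l) (hl1 : l ≠ -1) (k : ℕ) :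
    coulombCoeff l η (k + 2) = coulombCoeff (l + 1) η (k + 2)
      - 2 * alphaR l η 0 * coulombCoeff (l + 1) η (k + 1)
      - 4 * betaR l η 1 * coulombCoeff (l + 2) η k := by
  have e1 : l + 1 ≠ 0 := fun h => hl1 (by linarith)
  have e2 : l + 2 ≠ 0 := by linarith
  have e3 : 2 * l + 3 ≠ 0 := by linarith
  have e4 : 2 * l + 5 ≠ 0 := by linarith
  have A := coulombCoeff_lower η hl hl1 (k + 1)
  have A1 := coulombCoeff_lower η (l := l + 1) (by linarith) (by linarith) (k + 1)
  have A0 := coulombCoeff_lower η (l := l + 1) (by linarith) (by linarith) k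
  have R := coulombCoeff_rec η (l := l + 2) (by linarith) k
  have hα : alphaR l η 0 = -(η / (l + 1) + η / (l + 2)) / (2 * (2 * l + 3)) := by
    simp only [alphaR, Nat.cast_zero, add_zero]
    field_simp
    ring
  have hβ : betaR l η 1 = (1 + (η / (l + 2)) ^ 2) / (4 * ((2 * l + 3) * (2 * l + 5))) := by
    have e5 : 2 * l + 2 + 1 ≠ 0 := by linarith
    have e6 : 2 * l + 2 + 2 ≠ 0 := by linarith
    have e7 : 2 * l + 2 + 3 ≠ 0 := by linarith
    have e8 : l + 1 + 1 ≠ 0 := by linarith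
    simp only [betaR, Nat.cast_one, mul_one]
    field_simp
    ring
  have hη : η = η / (l + 2) * (l + 2) := by field_simp
  rw [hα, hβ]
  rw [show l + 1 + 1 = l + 2 by ring] at A1 A0
  generalize η / (l + 2) = s at *
  generalize η / (l + 1) = t at *
  push_cast at *
  simp only [add_assoc, Nat.reduceAdd] at *
  generalize coulombCoeff l η (k + 2) = c2 at *
  generalize coulombCoeff (l + 1) η (k + 2) = b2 at *
  generalize coulombCoeff (l + 1) η (k + 1) = b1 at *
  generalize coulombCoeff (l + 2) η (k + 2) = a2 at *
  generalize coulombCoeff (l + 2) η (k + 1) = a1 at *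
  generalize coulombCoeff (l + 2) η k = a0 at *
  generalize (k : ℝ) = x at *
  have B : (2 * l + 5) * ((x + 2) * b2 - s * b1) = -(1 + s ^ 2) * a0 := by
    linear_combination (x + 2) * A1 - s * A0 + R + 2 * a1 * hη
  field_simp
  linear_combination (2 * l + 5) * A + B

lemma abs_coulombCoeff_add_two_le {l : ℝ} (η : ℝ) (hl : -3/2 < l) (k : ℕ) :
    ((k : ℝ) + 2) * (k + 2 * l + 3) * |coulombCoeff l η (k + 2)| ≤
      2 * |η| * |coulombCoeff l η (k + 1)| + |coulombCoeff l η k| := by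
  have hk : (0 : ℝ) ≤ k := k.cast_nonneg
  have hp : 0 < ((k : ℝ) + 2) * (k + 2 * l + 3) := mul_pos (by linarith) (by linarith)
  calc _ = |((k : ℝ) + 2) * (k + 2 * l + 3) * coulombCoeff l η (k + 2)| := by
        rw [abs_mul, abs_of_pos hp]
    _ = |2 * η * coulombCoeff l η (k + 1) - coulombCoeff l η k| := by
        rw [coulombCoeff_rec η hl]
    _ ≤ _ := (abs_sub _ _).trans (le_of_eq (by simp [abs_mul]))

lemma abs_coulombCoeff_le {l : ℝ} (η : ℝ) (hl : -1/2 ≤ l) (k : ℕ) :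
    |coulombCoeff l η k| ≤ (1 + 2 * |η|) ^ k / (k.factorial : ℝ) := by
  have hM : 0 ≤ |η| := abs_nonneg η
  induction k using Nat.twoStepInduction with
  | zero => simp [coulombCoeff_zero]
  | one =>
    have : (0 : ℝ) < l + 1 := by linarith
    rw [coulombCoeff_one, abs_div, abs_of_pos this, div_le_iff₀ this]
    simp only [pow_one, Nat.factorial_one, Nat.cast_one, div_one]
    nlinarith
  | more k h0 h1 =>
    have hk : (0 : ℝ) ≤ k := k.cast_nonneg
    have habs := abs_coulombCoeff_add_two_le η (by linarith : -3/2 < l) k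
    have hf : (0 : ℝ) < k.factorial := by exact_mod_cast k.factorial_pos
    have hlow : ((k : ℝ) + 2) * (k + 2) * |coulombCoeff l η (k + 2)| ≤
        ((k : ℝ) + 2) * (k + 2 * l + 3) * |coulombCoeff l η (k + 2)| := by
      exact mul_le_mul_of_nonneg_right (mul_le_mul_of_nonneg_left (by linarith) (by linarith))
        (abs_nonneg _)
    have hMk : 0 ≤ (1 + 2 * |η|) ^ k := by positivity
    rw [le_div_iff₀ (by positivity)] at h0 h1 ⊢
    rw [Nat.factorial_succ] at h1
    rw [Nat.factorial_succ, Nat.factorial_succ]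
    push_cast at *
    have key := mul_le_mul_of_nonneg_left (hlow.trans habs)
      (by positivity : 0 ≤ ((k : ℝ) + 1) * k.factorial)
    have h1' := mul_le_mul_of_nonneg_left h1 (by positivity : 0 ≤ 2 * |η|)
    have h0' := mul_le_mul_of_nonneg_left h0 (by positivity : 0 ≤ (k : ℝ) + 1)
    have hfin : 2 * |η| * (1 + 2 * |η|) ^ (k + 1) + (k + 1) * (1 + 2 * |η|) ^ k ≤
        (k + 2) * (1 + 2 * |η|) ^ (k + 2) := by
      have : 2 * |η| * (1 + 2 * |η|) + (k + 1) ≤ (k + 2) * (1 + 2 * |η|) ^ 2 := by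
        have h5 : 0 ≤ |η| * k := by positivity
        have h6 : 0 ≤ |η| ^ 2 * k := by positivity
        nlinarith
      calc _ = (2 * |η| * (1 + 2 * |η|) + (k + 1)) * (1 + 2 * |η|) ^ k := by ring
        _ ≤ ((k + 2) * (1 + 2 * |η|) ^ 2) * (1 + 2 * |η|) ^ k := by gcongr
        _ = _ := by ring
    refine le_of_mul_le_mul_left ?_ (by positivity : (0 : ℝ) < k + 2)
    linarith

lemma abs_coulombCoeff_succ_le {l : ℝ} (η : ℝ) (hl : -1/2 ≤ l) (k : ℕ) :
    |coulombCoeff l η (k + 1)| ≤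
      (1 + 2 * |η|) / (l + 1) * ((1 + 2 * |η|) ^ k / (k.factorial : ℝ)) := by
  have hM : 0 ≤ |η| := abs_nonneg η
  have hp1 : (0 : ℝ) < l + 1 := by linarith
  cases k with
  | zero =>
    rw [zero_add, coulombCoeff_one, abs_div, abs_of_pos hp1]
    simp only [pow_zero, Nat.factorial_zero, Nat.cast_one, div_one, mul_one]
    gcongr
    linarith
  | succ k =>
    have hk : (0 : ℝ) ≤ k := k.cast_nonneg
    have habs := abs_coulombCoeff_add_two_le η (by linarith : -3/2 < l) k
    have hlow : ((k : ℝ) + 1) * (l + 1) * |coulombCoeff l η (k + 2)| ≤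
        ((k : ℝ) + 2) * (k + 2 * l + 3) * |coulombCoeff l η (k + 2)| := by
      exact mul_le_mul_of_nonneg_right (mul_le_mul (by linarith) (by linarith) hp1.le
        (by linarith)) (abs_nonneg _)
    have h0 := abs_coulombCoeff_le η hl k
    have h1 := abs_coulombCoeff_le η hl (k + 1)
    have h1' : |coulombCoeff l η (k + 1)| ≤ (1 + 2 * |η|) ^ (k + 1) / (k.factorial : ℝ) := by
      refine h1.trans ?_
      gcongr
      omega
    have hfin : 2 * |η| * |coulombCoeff l η (k + 1)| + |coulombCoeff l η k| ≤
        (1 + 2 * |η|) ^ (k + 2) / (k.factorial : ℝ) := by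
      calc _ ≤ 2 * |η| * ((1 + 2 * |η|) ^ (k + 1) / (k.factorial : ℝ))
            + (1 + 2 * |η|) * ((1 + 2 * |η|) ^ k / (k.factorial : ℝ)) := by
            have : 0 ≤ (1 + 2 * |η|) ^ k / (k.factorial : ℝ) := by positivity
            gcongr
            nlinarith
        _ = _ := by ring
    have := (hlow.trans habs).trans hfin
    rw [← le_div_iff₀' (by positivity)] at this
    refine this.trans (le_of_eq ?_)
    rw [Nat.factorial_succ]
    push_cast
    field_simp
    ring

lemma hasSum_coulombPhiC_of_le {l : ℝ} (η : ℝ) (hl : -1/2 ≤ l) (z : ℂ) :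
    HasSum (fun k : ℕ => (coulombCoeff l η k : ℂ) * z ^ k) (coulombPhiC l η z) := by
  refine Summable.hasSum (Summable.of_norm_bounded
    (Real.summable_pow_div_factorial ((1 + 2 * |η|) * ‖z‖)) fun k => ?_)
  rw [norm_mul, norm_pow, Complex.norm_real, Real.norm_eq_abs, mul_pow, ← div_mul_eq_mul_div]
  gcongr
  exact abs_coulombCoeff_le η hl k

lemma hasSum_pow_div_factorial (x : ℝ) :
    HasSum (fun k : ℕ => x ^ k / (k.factorial : ℝ)) (Real.exp x) := by
  rw [Real.exp_eq_exp_ℝ]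
  exact NormedSpace.expSeries_div_hasSum_exp x

lemma norm_coulombPhiC_sub_one_le {l r : ℝ} (η : ℝ) (hl : -1/2 ≤ l) {z : ℂ} (hz : ‖z‖ ≤ r) :
    ‖coulombPhiC l η z - 1‖ ≤
      (1 + 2 * |η|) * r * Real.exp ((1 + 2 * |η|) * r) / (l + 1) := by
  have hr : 0 ≤ r := (norm_nonneg z).trans hz
  have hp : 0 < l + 1 := by linarith
  have h := (hasSum_nat_add_iff' (f := fun k : ℕ => (coulombCoeff l η k : ℂ) * z ^ k) 1).mpr
    (hasSum_coulombPhiC_of_le η hl z)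
  simp only [Finset.sum_range_one, coulombCoeff_zero, pow_zero, mul_one, Complex.ofReal_one] at h
  have he : HasSum (fun k : ℕ => (1 + 2 * |η|) * r / (l + 1) *
      (((1 + 2 * |η|) * r) ^ k / (k.factorial : ℝ)))
      ((1 + 2 * |η|) * r / (l + 1) * Real.exp ((1 + 2 * |η|) * r)) := by
    exact (hasSum_pow_div_factorial _).mul_left _
  rw [← h.tsum_eq]
  have hD : (1 + 2 * |η|) * r * Real.exp ((1 + 2 * |η|) * r) / (l + 1) =
      (1 + 2 * |η|) * r / (l + 1) * Real.exp ((1 + 2 * |η|) * r) := by ring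
  rw [hD]
  refine tsum_of_norm_bounded he fun k => ?_
  rw [norm_mul, norm_pow, Complex.norm_real, Real.norm_eq_abs]
  calc _ ≤ (1 + 2 * |η|) / (l + 1) * ((1 + 2 * |η|) ^ k / (k.factorial : ℝ)) * r ^ (k + 1) := by
        gcongr
        exact abs_coulombCoeff_succ_le η hl k
    _ = _ := by rw [mul_pow]; ring

lemma coulombPhiC_contiguous {l : ℝ} (η : ℝ) (hl : -3/2 < l) (hl1 : l ≠ -1) (z : ℂ) :
    coulombPhiC l η z = (1 - 2 * z * alphaR l η 0) * coulombPhiC (l + 1) η z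
      - 4 * z ^ 2 * betaR l η 1 * coulombPhiC (l + 2) η z := by
  have h0 := hasSum_coulombPhiC_of_le η (by linarith : -1/2 ≤ l + 1) z
  have h2 := (hasSum_coulombPhiC_of_le η (by linarith : -1/2 ≤ l + 2) z).mul_left
    (4 * z ^ 2 * betaR l η 1 : ℂ)
  have h1 := ((hasSum_nat_add_iff' 1).mpr h0).mul_left (2 * z * alphaR l η 0 : ℂ)
  have h := (((hasSum_nat_add_iff' 2).mpr h0).sub h1).sub h2
  have hterm : (fun k : ℕ => (coulombCoeff (l + 1) η (k + 2) : ℂ) * z ^ (k + 2) -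
      2 * z * alphaR l η 0 * (coulombCoeff (l + 1) η (k + 1) * z ^ (k + 1)) -
      4 * z ^ 2 * betaR l η 1 * (coulombCoeff (l + 2) η k * z ^ k)) =
      fun k : ℕ => (coulombCoeff l η (k + 2) : ℂ) * z ^ (k + 2) := by
    funext k
    rw [coulombCoeff_contiguous η hl hl1 k]
    push_cast
    ring
  rw [hterm] at h
  have e1 : l + 1 ≠ 0 := fun h => hl1 (by linarith)
  have e2 : l + 2 ≠ 0 := by linarith
  have hα : 2 * alphaR l η 0 = η / (l + 2) - η / (l + 1) := by
    simp only [alphaR, Nat.cast_zero, add_zero]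
    field_simp
    ring
  have hα' : 2 * (alphaR l η 0 : ℂ) = (η / (l + 2) - η / (l + 1) : ℂ) := by exact_mod_cast hα
  have h3 := ((hasSum_nat_add_iff
    (f := fun k : ℕ => (coulombCoeff l η k : ℂ) * z ^ k) 2).mp h).tsum_eq
  rw [coulombPhiC, h3]
  simp only [Finset.sum_range_succ, Finset.sum_range_zero, coulombCoeff_zero, coulombCoeff_one]
  push_cast
  rw [show (l : ℂ) + 1 + 1 = l + 2 by ring]
  linear_combination z * hα'

lemma natDegree_Rpoly_le (l η : ℝ) (n : ℕ) : (Rpoly l η n).natDegree ≤ n := by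
  induction n using Nat.twoStepInduction with
  | zero => simp [Rpoly]
  | one => rw [Rpoly]; compute_degree
  | more n h0 h1 =>
    rw [Rpoly]
    have hmul := natDegree_mul_le_of_le (natDegree_X_sub_C_le (alphaR l η (n + 1))) h1
    have hC := natDegree_C_mul_le (betaR l η (n + 1)) (Rpoly l η n)
    exact (natDegree_sub_le _ _).trans (max_le (by omega) (by omega))

lemma reflect_X_sub_C (a : ℝ) : reflect 1 (X - C a) = 1 - C a * X := by
  rw [reflect_sub, reflect_C, pow_one, reflect_one_X]

lemma reversedR_zero (l η : ℝ) (z : ℂ) : reversedR l η 0 z = 1 := by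
  simp [reversedR, Rpoly]

lemma reversedR_one (l η : ℝ) (z : ℂ) :
    reversedR l η 1 z = 1 - 2 * z * alphaR l η 0 := by
  have h : Rpoly l η 1 = X - C (alphaR l η 0) := by
    rw [Rpoly, alphaR, Nat.cast_zero, neg_div, C_neg, sub_neg_eq_add, add_zero]
  rw [reversedR, h, reflect_X_sub_C]
  simp
  ring

lemma reversedR_add_two (l η : ℝ) (n : ℕ) (z : ℂ) :
    reversedR l η (n + 2) z = (1 - 2 * z * alphaR l η (n + 1)) * reversedR l η (n + 1) z
      - 4 * z ^ 2 * betaR l η (n + 1) * reversedR l η n z := by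
  have h1 := reflect_mul (X - C (alphaR l η (n + 1))) (Rpoly l η (n + 1))
    (natDegree_X_sub_C_le _) (natDegree_Rpoly_le l η (n + 1))
  have h2 := reflect_mul (1 : ℝ[X]) (Rpoly l η n) (F := 2) (by simp) (natDegree_Rpoly_le l η n)
  rw [one_mul, reflect_one] at h2
  rw [reversedR, Rpoly, reflect_sub, reflect_C_mul, show n + 2 = 1 + (n + 1) by ring, h1,
    show 1 + (n + 1) = 2 + n by ring, h2, reflect_X_sub_C]
  simp [reversedR]
  ring

lemma alphaR_shift (l η : ℝ) (n : ℕ) : alphaR (l + n) η 0 = alphaR l η n := by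
  simp [alphaR]

lemma betaR_shift (l η : ℝ) (n : ℕ) : betaR (l + n) η 1 = betaR l η (n + 1) := by
  simp only [betaR]
  push_cast
  congr 1 <;> ring

lemma coulombPhiC_eq_reversedR {l : ℝ} (η : ℝ) (hl : -3/2 < l) (hl1 : l ≠ -1) (z : ℂ) (n : ℕ) :
    coulombPhiC l η z = reversedR l η (n + 1) z * coulombPhiC (l + (n + 1 : ℕ)) η z
      - 4 * z ^ 2 * betaR l η (n + 1) * reversedR l η n z *
        coulombPhiC (l + (n + 2 : ℕ)) η z := by
  induction n with
  | zero =>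
    rw [reversedR_zero, zero_add, reversedR_one]
    simpa using coulombPhiC_contiguous η hl hl1 z
  | succ n ih =>
    have hn : (0 : ℝ) ≤ n := n.cast_nonneg
    have h := coulombPhiC_contiguous (l := l + (n + 1 : ℕ)) η (by push_cast; linarith)
      (by push_cast; linarith) z
    rw [alphaR_shift, betaR_shift] at h
    rw [ih, reversedR_add_two, h]
    push_cast
    simp only [add_assoc, one_add_one_eq_two, (by norm_num : (1 : ℝ) + 2 = 3)]
    ring

lemma summable_of_le_inv_sq {f : ℕ → ℝ} {c : ℝ}
    (h : ∀ n : ℕ, |f (n + 2)| ≤ c / ((n : ℝ) + 1) ^ 2) : Summable fun n => |f n| := by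
  rw [← summable_nat_add_iff 2]
  have hs : Summable fun n : ℕ => 1 / ((n : ℝ) + 1) ^ 2 := by
    have := (summable_nat_add_iff 1).mpr (Real.summable_one_div_nat_pow.mpr one_lt_two)
    simpa using this
  refine Summable.of_nonneg_of_le (fun _ => abs_nonneg _) h ?_
  simpa [div_eq_mul_inv] using hs.mul_left c

lemma summable_abs_alphaR {l : ℝ} (η : ℝ) (hl : -3/2 < l) :
    Summable fun n => |alphaR l η n| := by
  refine summable_of_le_inv_sq (c := |η|) fun n => ?_
  have hn : (0 : ℝ) ≤ n := n.cast_nonneg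
  have hd : ((n : ℝ) + 1) ^ 2 ≤ 2 * (l + (n + 2 : ℕ) + 1) * (l + (n + 2 : ℕ) + 2) := by
    push_cast
    nlinarith
  rw [alphaR, abs_div, abs_neg, abs_of_pos (lt_of_lt_of_le (by positivity) hd)]
  gcongr

lemma summable_abs_betaR {l : ℝ} (η : ℝ) (hl : -3/2 < l) :
    Summable fun n => |betaR l η n| := by
  refine summable_of_le_inv_sq (c := 1 + η ^ 2) fun n => ?_
  have hn : (0 : ℝ) ≤ n := n.cast_nonneg
  obtain ⟨x, hx⟩ : ∃ x : ℝ, x = l + (n + 2 : ℕ) + 1 := ⟨_, rfl⟩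
  have hxn : (n : ℝ) + 3 / 2 ≤ x := by rw [hx]; push_cast; linarith
  have hβ : betaR l η (n + 2) = (x ^ 2 + η ^ 2) / (4 * x ^ 2 * ((2 * x - 1) * (2 * x + 1))) := by
    rw [betaR, hx]
    congr 1
    ring
  have h1 : ((n : ℝ) + 1) ^ 2 ≤ (2 * x - 1) * (2 * x + 1) := by nlinarith
  have h2 : x ^ 2 + η ^ 2 ≤ (1 + η ^ 2) * (4 * x ^ 2) := by
    nlinarith [mul_nonneg (sq_nonneg η) (by nlinarith : 0 ≤ x ^ 2 - 1)]
  have hx0 : 0 < x := by linarith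
  have h3 : 0 < (2 * x - 1) * (2 * x + 1) := lt_of_lt_of_le (by positivity) h1
  rw [hβ, abs_of_nonneg (by positivity)]
  calc _ ≤ (1 + η ^ 2) * (4 * x ^ 2) / (4 * x ^ 2 * ((2 * x - 1) * (2 * x + 1))) := by gcongr
    _ = (1 + η ^ 2) / ((2 * x - 1) * (2 * x + 1)) := by field_simp
    _ ≤ _ := by gcongr

lemma norm_reversedR_le_prod (l η : ℝ) {r : ℝ} {z : ℂ} (hz : ‖z‖ ≤ r) (n : ℕ) :
    ‖reversedR l η n z‖ ≤ ∏ j ∈ Finset.range n, (1 + reversedBoundTerm l η r j) := by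
  have hr : 0 ≤ r := (norm_nonneg z).trans hz
  have hpos : ∀ j, 0 ≤ reversedBoundTerm l η r j := fun j => by
    unfold reversedBoundTerm; positivity
  have hlin (j : ℕ) : ‖1 - 2 * z * (alphaR l η j : ℂ)‖ ≤ 1 + 2 * r * |alphaR l η j| := by
    refine (norm_sub_le _ _).trans ?_
    simp only [norm_one, norm_mul, Complex.norm_real, Real.norm_eq_abs, Complex.norm_ofNat]
    gcongr
  induction n using Nat.twoStepInduction with
  | zero => simp [reversedR_zero]
  | one =>
    rw [reversedR_one, Finset.prod_range_one]
    refine (hlin 0).trans ?_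
    have : 0 ≤ 4 * r ^ 2 * |betaR l η 0| := by positivity
    unfold reversedBoundTerm
    linarith
  | more n h0 h1 =>
    have hmono : ∏ j ∈ Finset.range n, (1 + reversedBoundTerm l η r j) ≤
        ∏ j ∈ Finset.range (n + 1), (1 + reversedBoundTerm l η r j) := by
      rw [Finset.prod_range_succ]
      exact le_mul_of_one_le_right
        (Finset.prod_nonneg fun j _ => by linarith [hpos j]) (by linarith [hpos n])
    rw [reversedR_add_two, Finset.prod_range_succ]
    have h0' := h0.trans hmono
    generalize ∏ j ∈ Finset.range (n + 1), (1 + reversedBoundTerm l η r j) = P at *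
    calc _ ≤ ‖1 - 2 * z * (alphaR l η (n + 1) : ℂ)‖ * ‖reversedR l η (n + 1) z‖ +
          4 * ‖z‖ ^ 2 * |betaR l η (n + 1)| * ‖reversedR l η n z‖ := by
          refine (norm_sub_le _ _).trans (le_of_eq ?_)
          simp [norm_pow]
      _ ≤ (1 + 2 * r * |alphaR l η (n + 1)|) * P + 4 * r ^ 2 * |betaR l η (n + 1)| * P := by
          gcongr
          exact hlin _
      _ = _ := by unfold reversedBoundTerm; ring

lemma exists_norm_reversedR_le {l : ℝ} (η : ℝ) (hl : -3/2 < l) {r : ℝ} (hr : 0 ≤ r) :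
    ∃ B : ℝ, 0 ≤ B ∧ ∀ (n : ℕ) (z : ℂ), ‖z‖ ≤ r → ‖reversedR l η n z‖ ≤ B := by
  have hpos : ∀ j, 0 ≤ reversedBoundTerm l η r j := fun j => by
    unfold reversedBoundTerm; positivity
  have hs : Summable (reversedBoundTerm l η r) :=
    ((summable_abs_alphaR η hl).mul_left _).add ((summable_abs_betaR η hl).mul_left _)
  refine ⟨Real.exp (∑' j, reversedBoundTerm l η r j), (Real.exp_pos _).le, fun n z hz => ?_⟩
  refine (norm_reversedR_le_prod l η hz n).trans ?_
  refine (Finset.prod_le_prod (fun j _ => by linarith [hpos j])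
    fun j _ => (add_comm _ _).trans_le (Real.add_one_le_exp _)).trans ?_
  rw [← Real.exp_sum]
  exact Real.exp_le_exp.mpr (hs.sum_le_tsum _ fun j _ => hpos j)

lemma tendstoUniformlyOn_reversedR_closedBall {l : ℝ} (η : ℝ) (hl : -3/2 < l) (hl1 : l ≠ -1)
    {r : ℝ} (hr : 0 ≤ r) :
    TendstoUniformlyOn (fun n z => reversedR l η n z) (coulombPhiC l η) Filter.atTop
      (Metric.closedBall 0 r) := by
  obtain ⟨B, hB0, hB⟩ := exists_norm_reversedR_le η hl hr
  set D : ℝ := (1 + 2 * |η|) * r * Real.exp ((1 + 2 * |η|) * r) with hD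
  have hE : Filter.Tendsto (fun n : ℕ => D / (l + n + 1)) Filter.atTop (nhds 0) :=
    Filter.Tendsto.const_div_atTop (Filter.tendsto_atTop_add_const_right _ _
      (Filter.tendsto_atTop_add_const_left _ _ tendsto_natCast_atTop_atTop)) _
  have hβ := (summable_abs_betaR η hl).tendsto_atTop_zero
  have hlim : Filter.Tendsto (fun n : ℕ => B * (D / (l + (n + 1 : ℕ) + 1)) +
      4 * r ^ 2 * |betaR l η (n + 1)| * B * (1 + D / (l + (n + 2 : ℕ) + 1)))
      Filter.atTop (nhds 0) := by
    have h := ((hE.comp (Filter.tendsto_add_atTop_nat 1)).const_mul B).add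
      ((((hβ.comp (Filter.tendsto_add_atTop_nat 1)).const_mul (4 * r ^ 2)).mul_const B).mul
        ((hE.comp (Filter.tendsto_add_atTop_nat 2)).const_add 1))
    simpa [Function.comp_def] using h
  rw [Metric.tendstoUniformlyOn_iff]
  intro ε hε
  obtain ⟨N, hN⟩ := Filter.eventually_atTop.mp (hlim.eventually_lt_const hε)
  filter_upwards [Filter.eventually_ge_atTop (N + 1)] with m hm z hz
  obtain ⟨n, rfl⟩ : ∃ n, m = n + 1 := ⟨m - 1, by omega⟩
  refine lt_of_le_of_lt ?_ (hN n (by omega))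
  have hz' : ‖z‖ ≤ r := by simpa using hz
  have hn : (0 : ℝ) ≤ n := n.cast_nonneg
  have h1 := norm_coulombPhiC_sub_one_le (l := l + (n + 1 : ℕ)) η
    (by push_cast; linarith) hz'
  have h2 := norm_coulombPhiC_sub_one_le (l := l + (n + 2 : ℕ)) η
    (by push_cast; linarith) hz'
  have h2' : ‖coulombPhiC (l + (n + 2 : ℕ)) η z‖ ≤ 1 + D / (l + (n + 2 : ℕ) + 1) := by
    have h := norm_add_le (coulombPhiC (l + (n + 2 : ℕ)) η z - 1) 1
    rw [sub_add_cancel, norm_one] at h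
    linarith
  rw [dist_eq_norm, coulombPhiC_eq_reversedR η hl hl1 z n]
  calc _ = ‖reversedR l η (n + 1) z * (coulombPhiC (l + (n + 1 : ℕ)) η z - 1) -
        4 * z ^ 2 * betaR l η (n + 1) * reversedR l η n z *
          coulombPhiC (l + (n + 2 : ℕ)) η z‖ := by congr 1; ring
    _ ≤ ‖reversedR l η (n + 1) z‖ * ‖coulombPhiC (l + (n + 1 : ℕ)) η z - 1‖ +
        4 * ‖z‖ ^ 2 * |betaR l η (n + 1)| * ‖reversedR l η n z‖ *
          ‖coulombPhiC (l + (n + 2 : ℕ)) η z‖ := by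
        refine (norm_sub_le _ _).trans (le_of_eq ?_)
        simp [norm_pow]
    _ ≤ _ := by
        gcongr
        · exact hB _ _ hz'
        · exact hB _ _ hz'

/-- Remark 5.1 / display (5.4): the reversed polynomials p_n(x) = (2x)^n R_{n,ℓ,η}(1/(2x))
converge to φ_{ℓ,η} uniformly on every compact subset of ℂ, and in particular pointwise. -/
theorem stmt_11 (l η : ℝ) (hl : -3/2 < l) (hl1 : l ≠ -1) (hη : η ≠ 0) :
    (∀ K : Set ℂ, IsCompact K →
        TendstoUniformlyOn (fun n z => reversedR l η n z) (coulombPhiC l η) Filter.atTop K) ∧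
      ∀ z : ℂ, Filter.Tendsto (fun n => reversedR l η n z) Filter.atTop
        (nhds (coulombPhiC l η z)) := by
  have hK : ∀ K : Set ℂ, IsCompact K →
      TendstoUniformlyOn (fun n z => reversedR l η n z) (coulombPhiC l η) Filter.atTop K := by
    intro K hK
    obtain ⟨r, hr, hKr⟩ := hK.isBounded.subset_closedBall_lt 0 0
    exact (tendstoUniformlyOn_reversedR_closedBall η hl hl1 hr.le).mono hKr
  exact ⟨hK, fun z => (hK {z} isCompact_singleton).tendsto_at (Set.mem_singleton z)⟩
end

section
/- Let η ≠ 0, ℓ > −3/2 with ℓ ≠ −1, and H ≥ 0. Then every complex zero of the entire function z ↦ z φ′_{ℓ,η}(z) + H φ_{ℓ,η}(z) is real. Equivalently, for h ≥ −ℓ−1, the function x F′_{ℓ,η}(x) + h F_{ℓ,η}(x) (whose zeros away from the origin coincide with those of z φ′_{ℓ,η}(z) + (h+ℓ+1) φ_{ℓ,η}(z)) has only real zeros. -/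
section RapidDecay

variable {a : ℕ → ℂ}

lemma summable_mul_pow_of_rapidDecay (ha : ∀ R : ℝ, 0 < R → ∃ C, ∀ k, ‖a k‖ * R ^ k ≤ C) (z : ℂ) :
    Summable fun k ↦ a k * z ^ k := by
  obtain ⟨C, hC⟩ := ha (2 * (‖z‖ + 1)) (by positivity)
  refine Summable.of_norm_bounded
    ((summable_geometric_of_lt_one (by norm_num) (by norm_num : (1 / 2 : ℝ) < 1)).mul_left C)
    fun k ↦ ?_
  calc ‖a k * z ^ k‖ = ‖a k‖ * ‖z‖ ^ k := by simp
    _ ≤ ‖a k‖ * (‖z‖ + 1) ^ k := by gcongr; linarith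
    _ = ‖a k‖ * (2 * (‖z‖ + 1)) ^ k * (1 / 2) ^ k := by
        rw [mul_assoc, ← mul_pow]; congr 2; ring
    _ ≤ C * (1 / 2) ^ k := by gcongr; exact hC k

lemma rapidDecay_derivative (ha : ∀ R : ℝ, 0 < R → ∃ C, ∀ k, ‖a k‖ * R ^ k ≤ C) :
    ∀ R : ℝ, 0 < R → ∃ C, ∀ k : ℕ, ‖((k : ℂ) + 1) * a (k + 1)‖ * R ^ k ≤ C := by
  intro R hR
  obtain ⟨C, hC⟩ := ha (2 * R) (by positivity)
  refine ⟨C / R, fun k ↦ ?_⟩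
  rw [le_div_iff₀ hR]
  have hk : ((k : ℝ) + 1) ≤ 2 ^ (k + 1) := by
    exact_mod_cast (Nat.lt_two_pow_self (n := k + 1)).le
  have hn : ‖(k : ℂ) + 1‖ = (k : ℝ) + 1 := by
    rw [← Nat.cast_succ, Complex.norm_natCast, Nat.cast_succ]
  calc ‖((k : ℂ) + 1) * a (k + 1)‖ * R ^ k * R
      = ((k : ℝ) + 1) * (‖a (k + 1)‖ * R ^ (k + 1)) := by rw [norm_mul, hn]; ring
    _ ≤ 2 ^ (k + 1) * (‖a (k + 1)‖ * R ^ (k + 1)) := by gcongr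
    _ = ‖a (k + 1)‖ * (2 * R) ^ (k + 1) := by rw [mul_pow]; ring
    _ ≤ C := hC _

lemma hasDerivAt_tsum_mul_pow (ha : ∀ R : ℝ, 0 < R → ∃ C, ∀ k, ‖a k‖ * R ^ k ≤ C) (z : ℂ) :
    HasDerivAt (fun z ↦ ∑' k, a k * z ^ k) (∑' k : ℕ, ((k : ℂ) + 1) * a (k + 1) * z ^ k) z := by
  set r := ‖z‖ + 1 with hr
  have hr1 : 1 ≤ r := by have := norm_nonneg z; linarith
  obtain ⟨C, hC⟩ := ha (4 * r) (by positivity)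
  have hbound : ∀ k : ℕ, ∀ y ∈ Metric.ball (0 : ℂ) r,
      ‖a k * ((k : ℂ) * y ^ (k - 1))‖ ≤ C * (1 / 2) ^ k := by
    intro k y hy
    have hy' : ‖y‖ ≤ r := by simpa using (Metric.mem_ball.1 hy).le
    have hk : (k : ℝ) ≤ 2 ^ k := by exact_mod_cast (Nat.lt_two_pow_self (n := k)).le
    calc ‖a k * ((k : ℂ) * y ^ (k - 1))‖ = ‖a k‖ * ((k : ℝ) * ‖y‖ ^ (k - 1)) := by simp
      _ ≤ ‖a k‖ * (2 ^ k * r ^ k) := by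
          gcongr
          calc ‖y‖ ^ (k - 1) ≤ r ^ (k - 1) := by gcongr
            _ ≤ r ^ k := pow_le_pow_right₀ hr1 (Nat.sub_le _ _)
      _ = ‖a k‖ * (4 * r) ^ k * (1 / 2) ^ k := by
          rw [mul_assoc, ← mul_pow, ← mul_pow]; congr 2; ring
      _ ≤ C * (1 / 2) ^ k := by gcongr; exact hC k
  have hsum : Summable fun k : ℕ ↦ C * (1 / 2 : ℝ) ^ k :=
    (summable_geometric_of_lt_one (by norm_num) (by norm_num)).mul_left C
  have hz : z ∈ Metric.ball (0 : ℂ) r := by simp [hr]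
  have key := hasDerivAt_tsum_of_isPreconnected hsum Metric.isOpen_ball
    (convex_ball (0 : ℂ) r).isPreconnected
    (g := fun k z ↦ a k * z ^ k) (g' := fun k y ↦ a k * ((k : ℂ) * y ^ (k - 1)))
    (fun k y _ ↦ (hasDerivAt_pow k y).const_mul (a k)) hbound hz
    (summable_mul_pow_of_rapidDecay ha z) hz
  refine key.congr_deriv ?_
  rw [(Summable.of_norm_bounded hsum fun k ↦ hbound k z hz).tsum_eq_zero_add]
  simp only [Nat.cast_zero, zero_mul, mul_zero, zero_add, Nat.cast_add, Nat.cast_one,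
    Nat.add_sub_cancel]
  exact tsum_congr fun k ↦ by ring

end RapidDecay

lemma coulombCoeff_rapidDecay {l : ℝ} (hl : -3 / 2 < l) (η : ℝ) :
    ∀ R : ℝ, 0 < R → ∃ C, ∀ k, ‖(coulombCoeff l η k : ℂ)‖ * R ^ k ≤ C := by
  intro R hR
  obtain ⟨K, hK⟩ := exists_nat_ge (2 * |η| * R + R ^ 2)
  set b : ℕ → ℝ := fun k ↦ |coulombCoeff l η k| * R ^ k with hb
  have hb0 : ∀ k, 0 ≤ b k := fun k ↦ by positivity
  have hstep : ∀ k, K ≤ k → ∀ M, b k ≤ M → b (k + 1) ≤ M → b (k + 2) ≤ M := by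
    intro k hk M h0 h1
    have hkK : (K : ℝ) ≤ k := by exact_mod_cast hk
    have hk0 : (0 : ℝ) ≤ k := by positivity
    set D : ℝ := ((k : ℝ) + 2) * (((k : ℝ) + 2) + 2 * l + 1) with hD
    have hDk : (k : ℝ) ≤ D := by nlinarith
    have hD0 : 0 < D := by rw [hD]; apply mul_pos <;> linarith
    have hM : 0 ≤ M := (hb0 k).trans h0
    have hrec : b (k + 2) * D =
        |2 * η * coulombCoeff l η (k + 1) - coulombCoeff l η k| * R ^ (k + 2) := by
      simp only [hb, coulombCoeff, abs_div]
      rw [← hD, abs_of_pos hD0]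
      field_simp
    have hle : b (k + 2) * D ≤ M * D := by
      calc b (k + 2) * D
          ≤ (|2 * η * coulombCoeff l η (k + 1)| + |coulombCoeff l η k|) * R ^ (k + 2) := by
            rw [hrec]; gcongr; exact abs_sub _ _
        _ = 2 * |η| * R * b (k + 1) + R ^ 2 * b k := by
            simp only [hb, abs_mul, abs_two]; ring
        _ ≤ 2 * |η| * R * M + R ^ 2 * M := by gcongr
        _ = M * (2 * |η| * R + R ^ 2) := by ring
        _ ≤ M * D := by gcongr; linarith
    exact le_of_mul_le_mul_right hle hD0
  set M := ∑ k ∈ Finset.range (K + 2), b k with hM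
  have hsmall : ∀ k < K + 2, b k ≤ M := fun k hk ↦
    Finset.single_le_sum (fun i _ ↦ hb0 i) (Finset.mem_range.2 hk)
  have hlarge : ∀ n, b (K + n) ≤ M ∧ b (K + n + 1) ≤ M := by
    intro n
    induction n with
    | zero => exact ⟨hsmall _ (by omega), hsmall _ (by omega)⟩
    | succ n ih => exact ⟨ih.2, hstep (K + n) (by omega) M ih.1 ih.2⟩
  refine ⟨M, fun k ↦ ?_⟩
  rw [Complex.norm_real, Real.norm_eq_abs]
  rcases lt_or_ge k K with hk | hk
  · exact hsmall k (by omega)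
  · obtain ⟨n, rfl⟩ := Nat.exists_eq_add_of_le hk
    exact (hlarge n).1

/-- The function `φ_{ℓ,η}` is twice differentiable and solves
`z φ'' + (2ℓ + 2) φ' + (z - 2η) φ = 0`. -/
lemma exists_coulombPhiC_derivs {l : ℝ} (hl : -3 / 2 < l) (hl1 : l ≠ -1) (η : ℝ) :
    ∃ φ₁ φ₂ : ℂ → ℂ, (∀ z, HasDerivAt (coulombPhiC l η) (φ₁ z) z) ∧
      (∀ z, HasDerivAt φ₁ (φ₂ z) z) ∧ coulombPhiC l η 0 = 1 ∧ φ₁ 0 = (η : ℂ) / (l + 1) ∧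
      ∀ z, z * φ₂ z + (2 * l + 2) * φ₁ z + (z - 2 * η) * coulombPhiC l η z = 0 := by
  have h0 := coulombCoeff_rapidDecay hl η
  have h1 := rapidDecay_derivative h0
  have h2 := rapidDecay_derivative h1
  have hl1' : (l : ℂ) + 1 ≠ 0 := by
    have : l + 1 ≠ 0 := fun h ↦ hl1 (by linarith)
    exact_mod_cast this
  have hsum_zero : ∀ f : ℕ → ℂ, ∑' k, f k * (0 : ℂ) ^ k = f 0 := fun f ↦ by
    rw [tsum_eq_single 0 fun k hk ↦ by simp [hk]]; simp
  refine ⟨_, _, hasDerivAt_tsum_mul_pow h0, hasDerivAt_tsum_mul_pow h1, ?_, ?_, fun z ↦ ?_⟩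
  · rw [coulombPhiC, hsum_zero]; simp [coulombCoeff]
  · rw [hsum_zero]; simp [coulombCoeff]
  · have s0 := summable_mul_pow_of_rapidDecay h0 z
    have s1 := summable_mul_pow_of_rapidDecay h1 z
    have s2 := summable_mul_pow_of_rapidDecay h2 z
    have t0 := (summable_nat_add_iff 1).2 s0
    have t1 := (summable_nat_add_iff 1).2 s1
    have e0 := s0.tsum_eq_zero_add
    have e1 := s1.tsum_eq_zero_add
    have key := (((s2.hasSum.mul_left z).add (t1.hasSum.mul_left (2 * l + 2 : ℂ))).add
      (s0.hasSum.mul_left z)).sub (t0.hasSum.mul_left (2 * η : ℂ))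
    rw [show (fun k : ℕ ↦ _) = fun _ ↦ (0 : ℂ) from funext fun k ↦ ?_] at key
    · have hsum := key.unique hasSum_zero
      have hc0 : (coulombCoeff l η 0 : ℂ) = 1 := by simp [coulombCoeff]
      have hc1 : ((l : ℂ) + 1) * coulombCoeff l η 1 = η := by
        simp only [coulombCoeff]; push_cast; field_simp
      simp only [pow_zero, mul_one, Nat.cast_zero, zero_add, one_mul] at e0 e1
      simp only [coulombPhiC]
      linear_combination hsum + (2 * l + 2 : ℂ) * e1 - 2 * η * e0 + 2 * hc1 - 2 * η * hc0
    · have hD : ((k : ℝ) + 2) * ((k : ℝ) + 2 + 2 * l + 1) ≠ 0 := by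
        have : (0 : ℝ) ≤ k := k.cast_nonneg
        exact (mul_pos (by linarith) (by linarith)).ne'
      have hrec : (((k : ℝ) + 2) * ((k : ℝ) + 2 + 2 * l + 1)) * coulombCoeff l η (k + 2) =
          2 * η * coulombCoeff l η (k + 1) - coulombCoeff l η k := by
        rw [coulombCoeff]; exact mul_div_cancel₀ _ hD
      have hrec' := congrArg (Complex.ofReal) hrec
      push_cast at hrec' ⊢
      linear_combination z ^ (k + 1) * hrec'

/-- A singular first-order comparison principle. -/
lemma pos_of_mul_deriv_add_mul_eq {c : ℝ} (hc : -1 < c) {p p' q : ℝ → ℝ}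
    (hp : ∀ t, HasDerivAt p (p' t) t) (hp0 : p 0 = 0) (hq : ∀ t, 0 ≤ q t) (hqc : Continuous q)
    (hq0 : 0 < q 0) (h : ∀ t, t * p' t + c * p t = t * q t) : 0 < p 1 := by
  set g : ℝ → ℝ := fun t ↦ t ^ c * p t with hg
  have hgd : ∀ t, 0 < t → HasDerivAt g (t ^ c * q t) t := by
    intro t ht
    have := (Real.hasDerivAt_rpow_const (p := c) (Or.inl ht.ne')).mul (hp t)
    refine this.congr_deriv ?_
    have h1 : t ^ c = t ^ (c - 1) * t := by
      rw [Real.rpow_sub_one ht.ne']; field_simp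
    rw [h1]
    linear_combination (t ^ (c - 1)) * h t
  have hmono : MonotoneOn g (Set.Ioi 0) := by
    apply monotoneOn_of_deriv_nonneg (convex_Ioi 0)
    · exact fun t ht ↦ (hgd t ht).continuousAt.continuousWithinAt
    · rw [interior_Ioi]
      exact fun t ht ↦ (hgd t ht).differentiableAt.differentiableWithinAt
    · rw [interior_Ioi]
      intro t ht
      rw [(hgd t ht).deriv]
      exact mul_nonneg (Real.rpow_nonneg (le_of_lt ht) _) (hq t)
  have hlim : Filter.Tendsto g (nhdsWithin 0 (Set.Ioi 0)) (nhds 0) := by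
    have h1 : Filter.Tendsto (fun t : ℝ ↦ t ^ (c + 1)) (nhdsWithin 0 (Set.Ioi 0)) (nhds 0) := by
      have := (Real.continuousAt_rpow_const 0 (c + 1) (Or.inr (by linarith))).tendsto
      rw [Real.zero_rpow (by linarith)] at this
      exact this.mono_left nhdsWithin_le_nhds
    have h2 := (hasDerivAt_iff_tendsto_slope_zero.1 (hp 0)).mono_left
      (nhdsWithin_mono 0 fun t (ht : 0 < t) ↦ ht.ne')
    have h3 := h1.mul h2
    rw [zero_mul] at h3
    refine h3.congr' ?_
    filter_upwards [self_mem_nhdsWithin] with t ht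
    have ht : 0 < t := ht
    simp only [hg, zero_add, hp0, sub_zero, smul_eq_mul]
    rw [Real.rpow_add_one ht.ne']
    field_simp
  have hnonneg : ∀ t, 0 < t → 0 ≤ g t := by
    intro t ht
    refine le_of_tendsto hlim ?_
    filter_upwards [Ioc_mem_nhdsGT ht] with s hs
    exact hmono hs.1 ht hs.2
  by_contra! hneg
  have hg1 : g 1 ≤ 0 := by simpa [hg] using hneg
  have hzero : ∀ t ∈ Set.Ioo (0 : ℝ) 1, g t = 0 := fun t ht ↦
    le_antisymm ((hmono ht.1 (Set.mem_Ioi.2 one_pos) ht.2.le).trans hg1) (hnonneg t ht.1)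
  have hqpos : ∀ᶠ t in nhdsWithin (0 : ℝ) (Set.Ioi 0), 0 < q t :=
    (hqc.continuousAt.eventually (lt_mem_nhds hq0)).filter_mono nhdsWithin_le_nhds
  obtain ⟨t, htq, ht⟩ := (hqpos.and (Ioo_mem_nhdsGT one_pos)).exists
  have hd : HasDerivAt g 0 t := (hasDerivAt_const t (0 : ℝ)).congr_of_eventuallyEq <| by
    filter_upwards [isOpen_Ioo.mem_nhds ht] with s hs using hzero s hs
  exact (mul_pos (Real.rpow_pos_of_pos ht.1 c) htq).ne' ((hgd t ht.1).unique hd)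

/-- Theorem 5.2: for H ≥ 0 the entire function z ↦ z φ'_{ℓ,η}(z) + H φ_{ℓ,η}(z) has only
real zeros; equivalently, for h ≥ −ℓ−1 the function x F'_{ℓ,η}(x) + h F_{ℓ,η}(x), whose
zeros away from the origin coincide with those of z φ'_{ℓ,η}(z) + (h+ℓ+1) φ_{ℓ,η}(z),
has only real zeros. -/
theorem stmt_15 (l η : ℝ) (hl : -3/2 < l) (hl1 : l ≠ -1) (hη : η ≠ 0) (H : ℝ) (hH : 0 ≤ H) :
    ∀ z : ℂ, z * deriv (coulombPhiC l η) z + (H : ℂ) * coulombPhiC l η z = 0 → z.im = 0 := by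
  intro z hz
  obtain ⟨φ₁, φ₂, hφ, hφ₁, hφ0, hφ₁0, hode⟩ := exists_coulombPhiC_derivs hl hl1 η
  set φ := coulombPhiC l η
  rw [(hφ z).deriv] at hz
  by_contra hy
  -- The real functional `L` vanishes at `z` and takes the values `1` at `1`, `-‖z‖ ^ 2` at `z ^ 2`.
  set L : ℂ →L[ℝ] ℝ := Complex.reCLM - (z.re / z.im) • Complex.imCLM with hL
  have hLapp : ∀ w, L w = w.re - z.re / z.im * w.im := fun w ↦ by simp [hL]
  have hline : ∀ t : ℝ, HasDerivAt (fun t : ℝ ↦ (t : ℂ) * z) z t := fun t ↦ by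
    simpa using (Complex.ofRealCLM.hasDerivAt (x := t)).mul_const z
  have hu : ∀ t : ℝ, HasDerivAt (fun t : ℝ ↦ φ (t * z)) (φ₁ (t * z) * z) t := fun t ↦
    (hφ _).comp t (hline t)
  have hu₁ : ∀ t : ℝ, HasDerivAt (fun t : ℝ ↦ φ₁ (t * z)) (φ₂ (t * z) * z) t := fun t ↦
    (hφ₁ _).comp t (hline t)
  have hw : ∀ t : ℝ, HasDerivAt (fun t : ℝ ↦ z * φ₁ (t * z) * star (φ (t * z)))
      (z * (φ₂ (t * z) * z) * star (φ (t * z)) + z * φ₁ (t * z) * star (φ₁ (t * z) * z)) t :=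
    fun t ↦ ((hu₁ t).const_mul z).mul (hu t).star
  have hp := fun t : ℝ ↦ L.hasFDerivAt.comp_hasDerivAt t (hw t)
  have hcφ : Continuous φ := continuous_iff_continuousAt.2 fun z ↦ (hφ z).continuousAt
  have hcφ₁ : Continuous φ₁ := continuous_iff_continuousAt.2 fun z ↦ (hφ₁ z).continuousAt
  have hz2 : 0 < Complex.normSq z := Complex.normSq_pos.2 fun h ↦ hy (by simp [h])
  have hpos := pos_of_mul_deriv_add_mul_eq (c := 2 * l + 2) (by linarith) hp
    (q := fun t ↦ Complex.normSq (φ₁ (t * z) * z) +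
      Complex.normSq z * Complex.normSq (φ (t * z))) ?_ ?_ ?_ ?_ ?_
  · have hw1 : z * φ₁ z * star (φ z) = ((-(H * Complex.normSq (φ z)) : ℝ) : ℂ) := by
      push_cast
      rw [← Complex.mul_conj]
      change _ * star _ = -(_ * (_ * star _))
      linear_combination star (φ z) * hz
    simp only [Function.comp_apply, Complex.ofReal_one, one_mul, hw1, hLapp, Complex.ofReal_re,
      Complex.ofReal_im, mul_zero, sub_zero] at hpos
    have := mul_nonneg hH (Complex.normSq_nonneg (φ z))
    linarith
  · have : z * φ₁ 0 = ((η / (l + 1) : ℝ) : ℂ) * z := by rw [hφ₁0]; push_cast; ring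
    simp only [Function.comp_apply, Complex.ofReal_zero, zero_mul, hφ0, star_one, mul_one, this,
      hLapp, Complex.re_ofReal_mul, Complex.im_ofReal_mul]
    field_simp
    ring
  · intro t
    have := Complex.normSq_nonneg (φ₁ (t * z) * z)
    have := mul_nonneg hz2.le (Complex.normSq_nonneg (φ (t * z)))
    positivity
  · fun_prop
  · simp only [Complex.ofReal_zero, zero_mul, hφ0, map_one, mul_one]
    have := Complex.normSq_nonneg (φ₁ 0 * z)
    linarith
  · intro t
    have e : (t : ℂ) * (z * (φ₂ (t * z) * z) * star (φ (t * z)) +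
          z * φ₁ (t * z) * star (φ₁ (t * z) * z)) +
        ((2 * l + 2 : ℝ) : ℂ) * (z * φ₁ (t * z) * star (φ (t * z))) =
        ((t * Complex.normSq (φ₁ (t * z) * z) : ℝ) : ℂ) +
          ((2 * η * Complex.normSq (φ (t * z)) : ℝ) : ℂ) * z -
          ((t * Complex.normSq (φ (t * z)) : ℝ) : ℂ) * z ^ 2 := by
      push_cast
      rw [← Complex.mul_conj, ← Complex.mul_conj]
      change _ = _ * (_ * star _) + _ * (_ * star _) * _ - _ * (_ * star _) * _
      linear_combination z * star (φ (t * z)) * hode (t * z)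
    have e' := congrArg L e
    have hLmul : ∀ (r : ℝ) (w : ℂ), L (r * w) = r * L w := fun r w ↦ by
      rw [← Complex.real_smul, map_smul, smul_eq_mul]
    have hLreal : ∀ r : ℝ, L r = r := fun r ↦ by simp [hLapp]
    have hLz : L z = 0 := by rw [hLapp]; field_simp; ring
    have hLz2 : L (z ^ 2) = -Complex.normSq z := by
      rw [hLapp, Complex.normSq_apply, sq, Complex.mul_re, Complex.mul_im]; field_simp; ring
    rw [map_add, map_sub, map_add, hLmul, hLmul, hLmul, hLmul, hLreal, hLz, hLz2] at e'
    simp only [Function.comp_apply]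
    linear_combination e'
end

section
/- Let η ≠ 0, ℓ > −3/2 with ℓ ≠ −1, and H > 0. Then the real zeros of the function x φ_{ℓ,η}(x) and the real zeros of the function x φ′_{ℓ,η}(x) + H φ_{ℓ,η}(x) strictly interlace: the two functions have no common zero, and between any two consecutive real zeros of either function there lies exactly one real zero of the other. -/
/-- The function φ_{ℓ,η}, real-valued on ℝ. -/
noncomputable def coulombPhi (l η x : ℝ) : ℝ := ∑' k : ℕ, coulombCoeff l η k * x ^ k

open Filter Topology Set

section Interlacing

variable {f g f' g' : ℝ → ℝ}

/-- Between two zeros of `f` there is a zero of `g`, provided the Wronskian of `f` and `g` never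
vanishes. -/
theorem exists_zero_of_wronskian_ne_zero (hf : ∀ x, HasDerivAt f (f' x) x)
    (hg : ∀ x, HasDerivAt g (g' x) x) (hW : ∀ x, f' x * g x - f x * g' x ≠ 0) {x y : ℝ}
    (hxy : x < y) (hx : f x = 0) (hy : f y = 0) : ∃ t ∈ Ioo x y, g t = 0 := by
  by_contra! hne
  have hg0 : ∀ t ∈ Icc x y, g t ≠ 0 := by
    intro t ht h
    rcases eq_or_lt_of_le ht.1 with rfl | h1
    · exact hW x (by simp [hx, h])
    rcases eq_or_lt_of_le ht.2 with rfl | h2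
    · exact hW t (by simp [hy, h])
    exact hne t ⟨h1, h2⟩ h
  have hd : ∀ t ∈ Icc x y, HasDerivAt (fun s => f s / g s)
      ((f' t * g t - f t * g' t) / g t ^ 2) t :=
    fun t ht => (hf t).div (hg t) (hg0 t ht)
  obtain ⟨c, hc, hc0⟩ := exists_hasDerivAt_eq_zero hxy
    (fun t ht => (hd t ht).continuousAt.continuousWithinAt) (by simp [hx, hy])
    (fun t ht => hd t (Ioo_subset_Icc_self ht))
  exact div_ne_zero (hW c) (pow_ne_zero 2 (hg0 c (Ioo_subset_Icc_self hc))) hc0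

/-- Between consecutive zeros of `f` there is exactly one zero of `g`, provided the Wronskian of
`f` and `g` never vanishes. -/
theorem existsUnique_zero_of_wronskian_ne_zero (hf : ∀ x, HasDerivAt f (f' x) x)
    (hg : ∀ x, HasDerivAt g (g' x) x) (hW : ∀ x, f' x * g x - f x * g' x ≠ 0) {x y : ℝ}
    (hxy : x < y) (hx : f x = 0) (hy : f y = 0) (hne : ∀ t ∈ Ioo x y, f t ≠ 0) :
    ∃! t, t ∈ Ioo x y ∧ g t = 0 := by
  have hW' : ∀ x, g' x * f x - g x * f' x ≠ 0 := fun x h => hW x (by linarith)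
  have key : ∀ s t, s ∈ Ioo x y → t ∈ Ioo x y → g s = 0 → g t = 0 → ¬ s < t := by
    intro s t hs ht hgs hgt hst
    obtain ⟨c, hc, hc0⟩ := exists_zero_of_wronskian_ne_zero hg hf hW' hst hgs hgt
    exact hne c ⟨hs.1.trans hc.1, hc.2.trans ht.2⟩ hc0
  obtain ⟨t, ht, ht0⟩ := exists_zero_of_wronskian_ne_zero hf hg hW hxy hx hy
  refine ⟨t, ⟨ht, ht0⟩, fun s ⟨hs, hs0⟩ => ?_⟩
  exact le_antisymm (not_lt.1 (key t s ht hs ht0 hs0)) (not_lt.1 (key s t hs ht hs0 ht0))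

end Interlacing

section ExpSeries

/-- If `|b k| ≤ M * B ^ k`, the exponential generating function of `b` converges everywhere. -/
theorem summable_egf {b : ℕ → ℝ} {M B : ℝ} (hb : ∀ k, |b k| ≤ M * B ^ k) (x : ℝ) :
    Summable fun k : ℕ => b k * (x ^ k / (k.factorial : ℝ)) := by
  refine Summable.of_norm_bounded
    (((Real.summable_pow_div_factorial (B * |x|)).mul_left M)) fun k => ?_
  rw [Real.norm_eq_abs, abs_mul, abs_div, abs_pow, Nat.abs_cast, mul_pow]
  calc |b k| * (|x| ^ k / (k.factorial : ℝ))
      ≤ M * B ^ k * (|x| ^ k / (k.factorial : ℝ)) := by gcongr; exact hb k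
    _ = M * (B ^ k * |x| ^ k / (k.factorial : ℝ)) := by ring

/-- Differentiating an exponential generating function shifts its coefficients. -/
theorem hasDerivAt_egf {b : ℕ → ℝ} {M B : ℝ} (hb : ∀ k, |b k| ≤ M * B ^ k) (x : ℝ) :
    HasDerivAt (fun y => ∑' k : ℕ, b k * (y ^ k / (k.factorial : ℝ)))
      (∑' k : ℕ, b (k + 1) * (x ^ k / (k.factorial : ℝ))) x := by
  have hb' : ∀ k, |b (k + 1)| ≤ M * B * B ^ k := fun k => (hb (k + 1)).trans_eq (by ring)
  have hterm : ∀ (k : ℕ) (y : ℝ), HasDerivAt (fun y => b (k + 1) *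
      (y ^ (k + 1) / ((k + 1).factorial : ℝ))) (b (k + 1) * (y ^ k / (k.factorial : ℝ))) y := by
    intro k y
    refine (((hasDerivAt_pow (k + 1) y).div_const ((k + 1).factorial : ℝ)).const_mul
      (b (k + 1))).congr_deriv ?_
    rw [Nat.factorial_succ]
    push_cast
    have : (k.factorial : ℝ) ≠ 0 := by positivity
    have : (k : ℝ) + 1 ≠ 0 := by positivity
    field_simp
  have hsplit : (fun y => ∑' k : ℕ, b k * (y ^ k / (k.factorial : ℝ))) =
      fun y => b 0 + ∑' k : ℕ, b (k + 1) * (y ^ (k + 1) / ((k + 1).factorial : ℝ)) := by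
    funext y
    rw [(summable_egf hb y).tsum_eq_zero_add]
    simp
  rw [hsplit]
  refine HasDerivAt.const_add _ ?_
  set R := |x| + 1
  refine hasDerivAt_tsum_of_isPreconnected
    (u := fun k : ℕ => M * B * ((B * R) ^ k / (k.factorial : ℝ))) (t := Ioo (-R) R)
    ((Real.summable_pow_div_factorial (B * R)).mul_left _) isOpen_Ioo isPreconnected_Ioo
    (fun k y _ => hterm k y) ?_ (y₀ := x) ?_ ?_ ?_
  · intro k y hy
    have hyR : |y| ≤ R := (abs_lt.2 hy).le
    rw [Real.norm_eq_abs, abs_mul, abs_div, abs_pow, Nat.abs_cast]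
    calc |b (k + 1)| * (|y| ^ k / (k.factorial : ℝ))
        ≤ M * B * B ^ k * (R ^ k / (k.factorial : ℝ)) := by
          have h0 : 0 ≤ M * B * B ^ k := (abs_nonneg _).trans (hb' k)
          gcongr
          exact hb' k
      _ = M * B * ((B * R) ^ k / (k.factorial : ℝ)) := by rw [mul_pow]; ring
  · exact abs_lt.1 (lt_add_one _)
  · exact (summable_nat_add_iff (f := fun k : ℕ => b k * (x ^ k / (k.factorial : ℝ))) 1).2
      (summable_egf hb x)
  · exact abs_lt.1 (lt_add_one _)

end ExpSeries

/-- If `x G' + p G ≥ 0` with `p > 0`, then `t ^ p G (t x) ≤ G x` for `0 ≤ t ≤ 1`. -/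
theorem rpow_mul_le_of_euler_nonneg {G G' : ℝ → ℝ} {p : ℝ} (hp : 0 < p)
    (hG : ∀ x, HasDerivAt G (G' x) x) (h : ∀ x, 0 ≤ x * G' x + p * G x) (x : ℝ) {t : ℝ}
    (ht : t ∈ Icc (0 : ℝ) 1) : t ^ p * G (t * x) ≤ G x := by
  have hmono : MonotoneOn (fun s : ℝ => s ^ p * G (s * x)) (Icc 0 1) := by
    refine monotoneOn_of_hasDerivWithinAt_nonneg (convex_Icc 0 1)
      (f' := fun s => s ^ (p - 1) * (s * x * G' (s * x) + p * G (s * x))) ?_ ?_ ?_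
    · refine ContinuousOn.mul
        (continuousOn_id.rpow_const fun s _ => Or.inr hp.le) ?_
      exact ((continuous_iff_continuousAt.2 fun s => (hG s).continuousAt).comp
        (continuous_id.mul continuous_const)).continuousOn
    · intro s hs
      rw [interior_Icc] at hs
      have h1 := (Real.hasDerivAt_rpow_const (p := p) (Or.inl hs.1.ne')).mul
        ((hG (s * x)).comp s ((hasDerivAt_id s).mul_const x))
      refine HasDerivAt.hasDerivWithinAt (h1.congr_deriv ?_)
      have : s ^ p = s ^ (p - 1) * s := by
        rw [← Real.rpow_add_one hs.1.ne']; ring_nf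
      simp only [Function.comp, id, this]
      ring
    · intro s hs
      rw [interior_Icc] at hs
      exact mul_nonneg (Real.rpow_nonneg hs.1.le _) (h _)
  simpa using hmono ht (right_mem_Icc.2 zero_le_one) ht.2

section CoulombODE

variable {l η : ℝ} {f₀ f₁ f₂ f₃ : ℝ → ℝ}

/-- A solution of the Coulomb equation with `f 0 = 1` has no multiple zero. -/
theorem sq_add_sq_pos_of_coulomb_ode (h₀ : ∀ x, HasDerivAt f₀ (f₁ x) x)
    (h₁ : ∀ x, HasDerivAt f₁ (f₂ x) x)
    (hode : ∀ x, x * f₂ x + (2 * l + 2) * f₁ x + (x - 2 * η) * f₀ x = 0) (hinit : f₀ 0 = 1)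
    (x : ℝ) : 0 < f₀ x ^ 2 + f₁ x ^ 2 := by
  set E : ℝ → ℝ := fun x => f₀ x ^ 2 + f₁ x ^ 2
  have hE : ∀ x, HasDerivAt E (2 * f₀ x * f₁ x + 2 * f₁ x * f₂ x) x := fun x =>
    (((h₀ x).pow 2).add ((h₁ x).pow 2)).congr_deriv (by simp)
  have hEnn : ∀ x, 0 ≤ E x := fun x => by positivity
  set K := 4 * (|l + 1| + |η|) + 1
  have hK : 0 < K := by positivity
  have heuler : ∀ x, 0 ≤ x * (2 * f₀ x * f₁ x + 2 * f₁ x * f₂ x) + K * E x := by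
    intro x
    have e : x * (2 * f₀ x * f₁ x + 2 * f₁ x * f₂ x) =
        4 * η * (f₀ x * f₁ x) - 4 * (l + 1) * f₁ x ^ 2 := by
      linear_combination 2 * f₁ x * hode x
    have h1 : |η * (f₀ x * f₁ x)| ≤ |η| * E x := by
      rw [abs_mul]
      gcongr
      exact abs_le.2 ⟨by simp only [E]; nlinarith [sq_nonneg (f₀ x + f₁ x)],
        by simp only [E]; nlinarith [sq_nonneg (f₀ x - f₁ x)]⟩
    have h2 : (l + 1) * f₁ x ^ 2 ≤ |l + 1| * E x :=
      mul_le_mul (le_abs_self _) (by simp only [E]; nlinarith [sq_nonneg (f₀ x)])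
        (sq_nonneg _) (abs_nonneg _)
    have h3 := neg_le_of_abs_le h1
    rw [e]
    have := hEnn x
    simp only [K]
    linarith
  refine lt_of_le_of_ne (hEnn x) fun hx => ?_
  have hvanish : ∀ t ∈ Ioc (0 : ℝ) 1, E (t * x) = 0 := by
    intro t ht
    have := rpow_mul_le_of_euler_nonneg hK hE heuler x ⟨ht.1.le, ht.2⟩
    have hE0 : E x = 0 := hx.symm
    rw [hE0] at this
    exact le_antisymm (nonpos_of_mul_nonpos_right this (Real.rpow_pos_of_pos ht.1 K)) (hEnn _)
  have hcont : Continuous fun t : ℝ => E (t * x) :=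
    (continuous_iff_continuousAt.2 fun s => (hE s).continuousAt).comp
      (continuous_id.mul continuous_const)
  have hlim : Tendsto (fun t : ℝ => E (t * x)) (𝓝[>] 0) (𝓝 (E (0 * x))) :=
    hcont.continuousAt.tendsto.mono_left nhdsWithin_le_nhds
  have hlim0 : Tendsto (fun t : ℝ => E (t * x)) (𝓝[>] 0) (𝓝 0) := by
    refine tendsto_const_nhds.congr' ?_
    filter_upwards [Ioc_mem_nhdsGT (zero_lt_one' ℝ)] with t ht using (hvanish t ht).symm
  have h0 := tendsto_nhds_unique hlim hlim0
  simp only [E, zero_mul, hinit] at h0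
  nlinarith [sq_nonneg (f₁ 0)]

/-- Solutions of the Coulomb equation with `l > -3/2` that are smooth at the origin satisfy the
Laguerre inequality. -/
theorem laguerre_inequality_of_coulomb_ode (hl : -3 / 2 < l) (h₀ : ∀ x, HasDerivAt f₀ (f₁ x) x)
    (h₁ : ∀ x, HasDerivAt f₁ (f₂ x) x) (h₂ : ∀ x, HasDerivAt f₂ (f₃ x) x)
    (hode : ∀ x, x * f₂ x + (2 * l + 2) * f₁ x + (x - 2 * η) * f₀ x = 0) (x : ℝ) :
    f₀ x * f₂ x ≤ f₁ x ^ 2 := by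
  have hode' : ∀ x, x * f₃ x + (2 * l + 3) * f₂ x + (x - 2 * η) * f₁ x + f₀ x = 0 := by
    intro x
    have hd := ((((hasDerivAt_id x).mul (h₂ x)).add ((h₁ x).const_mul (2 * l + 2))).add
      (((hasDerivAt_id x).sub_const (2 * η)).mul (h₀ x)))
    have hz : HasDerivAt (fun _ : ℝ => (0 : ℝ)) 0 x := hasDerivAt_const x 0
    have := (hd.congr_of_eventuallyEq (Eventually.of_forall fun y => (hode y).symm)).unique hz
    simp only [id] at this
    linarith
  have hG : ∀ x, HasDerivAt (fun x => f₁ x ^ 2 - f₀ x * f₂ x)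
      (f₁ x * f₂ x - f₀ x * f₃ x) x := fun x =>
    (((h₁ x).pow 2).sub ((h₀ x).mul (h₂ x))).congr_deriv (by simp; ring)
  have heuler : ∀ x, 0 ≤ x * (f₁ x * f₂ x - f₀ x * f₃ x) +
      (2 * l + 3) * (f₁ x ^ 2 - f₀ x * f₂ x) := by
    intro x
    have : x * (f₁ x * f₂ x - f₀ x * f₃ x) + (2 * l + 3) * (f₁ x ^ 2 - f₀ x * f₂ x) =
        f₀ x ^ 2 + f₁ x ^ 2 := by
      linear_combination f₁ x * hode x - f₀ x * hode' x
    rw [this]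
    positivity
  have hp : 0 < 2 * l + 3 := by linarith
  have := rpow_mul_le_of_euler_nonneg hp hG heuler x (left_mem_Icc.2 zero_le_one)
  rw [Real.zero_rpow hp.ne', zero_mul] at this
  linarith

end CoulombODE

section CoulombSeries

/-- The derivatives at the origin of `coulombPhi l η`. -/
noncomputable def coulombTaylor (l η : ℝ) (k : ℕ) : ℝ := k.factorial * coulombCoeff l η k

theorem coulombTaylor_rec {l : ℝ} (η : ℝ) (hl : -3 / 2 < l) (k : ℕ) :
    ((k : ℝ) + 2 * l + 3) * coulombTaylor l η (k + 2) =
      2 * η * coulombTaylor l η (k + 1) - (k + 1) * coulombTaylor l η k := by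
  have h1 : (k : ℝ) + 2 + 2 * l + 1 ≠ 0 := by
    have : (0 : ℝ) ≤ k := k.cast_nonneg
    linarith
  have h2 : (k : ℝ) + 2 ≠ 0 := by positivity
  simp only [coulombTaylor, coulombCoeff, Nat.factorial_succ]
  push_cast
  field_simp
  ring

theorem exists_abs_coulombTaylor_le {l : ℝ} (η : ℝ) (hl : -3 / 2 < l) :
    ∃ B : ℝ, ∀ k, |coulombTaylor l η k| ≤ 1 * B ^ k := by
  set b := coulombTaylor l η
  set c := min 1 (2 * l + 3)
  have hc : 0 < c := lt_min one_pos (by linarith)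
  set A := (2 * |η| + 1) / c
  have hA : 0 ≤ A := by positivity
  have hstep : ∀ k, |b (k + 2)| ≤ A * |b (k + 1)| + A * |b k| := by
    intro k
    have hk : (0 : ℝ) ≤ k := k.cast_nonneg
    have hck : c * (k + 1) ≤ k + 2 * l + 3 := by
      have h1 : c ≤ 1 := min_le_left _ _
      have h2 : c ≤ 2 * l + 3 := min_le_right _ _
      nlinarith
    have hrec : |((k : ℝ) + 2 * l + 3) * b (k + 2)| ≤
        2 * |η| * |b (k + 1)| + (k + 1) * |b k| := by
      rw [coulombTaylor_rec η hl k]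
      refine (abs_sub _ _).trans_eq ?_
      rw [abs_mul, abs_mul, abs_mul, abs_two, abs_of_nonneg (by positivity : (0 : ℝ) ≤ k + 1)]
    have hpos : (0 : ℝ) < k + 1 := by positivity
    rw [abs_mul, abs_of_nonneg ((by positivity : 0 ≤ c * (k + 1)).trans hck)] at hrec
    have hle : c * (k + 1) * |b (k + 2)| ≤ c * (k + 1) * (A * |b (k + 1)| + A * |b k|) := by
      calc c * (k + 1) * |b (k + 2)| ≤ (k + 2 * l + 3) * |b (k + 2)| := by gcongr
        _ ≤ 2 * |η| * |b (k + 1)| + (k + 1) * |b k| := hrec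
        _ ≤ (k + 1) * ((2 * |η| + 1) * |b (k + 1)| + (2 * |η| + 1) * |b k|) := by
          have := abs_nonneg (b (k + 1))
          have := abs_nonneg (b k)
          have := abs_nonneg η
          have e1 : 0 ≤ k * (|η| * |b (k + 1)|) := by positivity
          have e2 : 0 ≤ k * |b (k + 1)| := by positivity
          have e3 : 0 ≤ (k + 1) * (|η| * |b k|) := by positivity
          nlinarith
        _ = c * (k + 1) * (A * |b (k + 1)| + A * |b k|) := by
          simp only [A]
          field_simp
    exact le_of_mul_le_mul_left hle (by positivity)
  set B := 1 + A + |b 1|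
  have hB : 1 ≤ B := by have := abs_nonneg (b 1); simp only [B]; linarith
  refine ⟨B, fun k => ?_⟩
  rw [one_mul]
  induction k using Nat.twoStepInduction with
  | zero => simp [b, coulombTaylor, coulombCoeff]
  | one => rw [pow_one]; simp only [B]; linarith
  | more k h1 h2 =>
    have hBk : 0 ≤ B ^ k := by positivity
    calc |b (k + 2)| ≤ A * |b (k + 1)| + A * |b k| := hstep k
      _ ≤ A * B ^ (k + 1) + A * B ^ k := by gcongr
      _ = (A * B + A) * B ^ k := by ring
      _ ≤ B ^ 2 * B ^ k := by
        gcongr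
        have : A + 1 ≤ B := by have := abs_nonneg (b 1); simp only [B]; linarith
        nlinarith
      _ = B ^ (k + 2) := by ring

/-- The `n`-th derivative of `coulombPhi l η`, as a power series. -/
noncomputable def coulombPhiDeriv (l η : ℝ) (n : ℕ) (x : ℝ) : ℝ :=
  ∑' k : ℕ, coulombTaylor l η (k + n) * (x ^ k / (k.factorial : ℝ))

theorem coulombPhi_eq_coulombPhiDeriv_zero (l η : ℝ) :
    coulombPhi l η = coulombPhiDeriv l η 0 := by
  funext x
  refine tsum_congr fun k => ?_
  have : (k.factorial : ℝ) ≠ 0 := by positivity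
  simp only [coulombTaylor, add_zero]
  field_simp

theorem exists_abs_coulombTaylor_add_le {l : ℝ} (η : ℝ) (hl : -3 / 2 < l) (n : ℕ) :
    ∃ M B : ℝ, ∀ k, |coulombTaylor l η (k + n)| ≤ M * B ^ k := by
  obtain ⟨B, hB⟩ := exists_abs_coulombTaylor_le η hl
  exact ⟨B ^ n, B, fun k => (hB (k + n)).trans_eq (by ring)⟩

theorem hasDerivAt_coulombPhiDeriv {l : ℝ} (η : ℝ) (hl : -3 / 2 < l) (n : ℕ) (x : ℝ) :
    HasDerivAt (coulombPhiDeriv l η n) (coulombPhiDeriv l η (n + 1) x) x := by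
  obtain ⟨M, B, hB⟩ := exists_abs_coulombTaylor_add_le η hl n
  refine (hasDerivAt_egf (b := fun k => coulombTaylor l η (k + n)) hB x).congr_deriv ?_
  exact tsum_congr fun k => by rw [add_right_comm, add_assoc]

theorem coulombPhi_zero (l η : ℝ) : coulombPhi l η 0 = 1 := by
  rw [coulombPhi, tsum_eq_single 0 fun k hk => by simp [hk]]
  simp [coulombCoeff]

theorem coulomb_ode {l : ℝ} (η : ℝ) (hl : -3 / 2 < l) (hl1 : l ≠ -1) (x : ℝ) :
    x * coulombPhiDeriv l η 2 x + (2 * l + 2) * coulombPhiDeriv l η 1 x +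
      (x - 2 * η) * coulombPhiDeriv l η 0 x = 0 := by
  have hs : ∀ n, Summable fun k : ℕ => coulombTaylor l η (k + n) *
      (x ^ k / (k.factorial : ℝ)) := by
    intro n
    obtain ⟨M, B, hB⟩ := exists_abs_coulombTaylor_add_le η hl n
    exact summable_egf hB x
  have htail : ∀ n, HasSum (fun k : ℕ => coulombTaylor l η (k + 1 + n) *
      (x ^ (k + 1) / ((k + 1).factorial : ℝ)))
        (coulombPhiDeriv l η n x - coulombTaylor l η n) := by
    intro n
    have := (hasSum_nat_add_iff' 1).2 (hs n).hasSum
    simpa [coulombPhiDeriv] using this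
  have hsum := ((((hs 2).hasSum.mul_left x).add ((htail 1).mul_left (2 * l + 2))).add
    ((hs 0).hasSum.mul_left x)).sub ((htail 0).mul_left (2 * η))
  have hzero : ∀ k : ℕ, x * (coulombTaylor l η (k + 2) * (x ^ k / (k.factorial : ℝ))) +
      (2 * l + 2) * (coulombTaylor l η (k + 1 + 1) * (x ^ (k + 1) / ((k + 1).factorial : ℝ))) +
      x * (coulombTaylor l η (k + 0) * (x ^ k / (k.factorial : ℝ))) -
      2 * η * (coulombTaylor l η (k + 1 + 0) * (x ^ (k + 1) / ((k + 1).factorial : ℝ))) = 0 := by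
    intro k
    have h1 : (k.factorial : ℝ) ≠ 0 := by positivity
    have h2 : (k : ℝ) + 1 ≠ 0 := by positivity
    rw [Nat.factorial_succ]
    push_cast
    simp only [add_zero, add_assoc, one_add_one_eq_two]
    field_simp
    linear_combination x * x ^ k * coulombTaylor_rec η hl k
  simp only [hzero] at hsum
  have h0 := hsum.unique hasSum_zero
  have hl1' : l + 1 ≠ 0 := fun h => hl1 (by linarith)
  have hb : (2 * l + 2) * coulombTaylor l η 1 = 2 * η * coulombTaylor l η 0 := by
    simp only [coulombTaylor, coulombCoeff, Nat.factorial_one, Nat.factorial_zero, Nat.cast_one]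
    field_simp
  change x * coulombPhiDeriv l η 2 x + (2 * l + 2) * (coulombPhiDeriv l η 1 x - _) +
    x * coulombPhiDeriv l η 0 x - 2 * η * (coulombPhiDeriv l η 0 x - _) = 0 at h0
  linear_combination h0 + hb

end CoulombSeries

/-- Theorem 5.3 (i): for H > 0 the real zeros of x φ_{ℓ,η}(x) and of
x φ'_{ℓ,η}(x) + H φ_{ℓ,η}(x) strictly interlace: no common zero, and between any two
consecutive real zeros of either function lies exactly one real zero of the other. -/
theorem stmt_16 (l η : ℝ) (hl : -3/2 < l) (hl1 : l ≠ -1) (hη : η ≠ 0) (H : ℝ) (hH : 0 < H) :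
    (∀ x : ℝ, ¬(x * coulombPhi l η x = 0 ∧
        x * deriv (coulombPhi l η) x + H * coulombPhi l η x = 0)) ∧
      (∀ x y : ℝ, x < y →
        x * coulombPhi l η x = 0 → y * coulombPhi l η y = 0 →
        (∀ t ∈ Set.Ioo x y, t * coulombPhi l η t ≠ 0) →
        ∃! t : ℝ, t ∈ Set.Ioo x y ∧ t * deriv (coulombPhi l η) t + H * coulombPhi l η t = 0) ∧
      ∀ x y : ℝ, x < y →
        x * deriv (coulombPhi l η) x + H * coulombPhi l η x = 0 →
        y * deriv (coulombPhi l η) y + H * coulombPhi l η y = 0 →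
        (∀ t ∈ Set.Ioo x y, t * deriv (coulombPhi l η) t + H * coulombPhi l η t ≠ 0) →
        ∃! t : ℝ, t ∈ Set.Ioo x y ∧ t * coulombPhi l η t = 0 := by
  have h₀ := hasDerivAt_coulombPhiDeriv η hl 0
  have h₁ := hasDerivAt_coulombPhiDeriv η hl 1
  have h₂ := hasDerivAt_coulombPhiDeriv η hl 2
  have hode := coulomb_ode η hl hl1
  have hinit := coulombPhi_zero l η
  have hderiv : ∀ x, deriv (coulombPhi l η) x = coulombPhiDeriv l η 1 x := fun x => by
    rw [coulombPhi_eq_coulombPhiDeriv_zero]; exact (h₀ x).deriv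
  simp only [hderiv]
  rw [coulombPhi_eq_coulombPhiDeriv_zero] at hinit ⊢
  have hF : ∀ x, HasDerivAt (fun x => x * coulombPhiDeriv l η 0 x)
      (coulombPhiDeriv l η 0 x + x * coulombPhiDeriv l η 1 x) x := fun x =>
    ((hasDerivAt_id x).mul (h₀ x)).congr_deriv (by simp)
  have hψ : ∀ x, HasDerivAt
      (fun x => x * coulombPhiDeriv l η 1 x + H * coulombPhiDeriv l η 0 x)
      (coulombPhiDeriv l η 1 x + x * coulombPhiDeriv l η 2 x + H * coulombPhiDeriv l η 1 x) x :=
    fun x => (((hasDerivAt_id x).mul (h₁ x)).add ((h₀ x).const_mul H)).congr_deriv (by simp)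
  have hW : ∀ x, 0 < (coulombPhiDeriv l η 0 x + x * coulombPhiDeriv l η 1 x) *
      (x * coulombPhiDeriv l η 1 x + H * coulombPhiDeriv l η 0 x) -
      x * coulombPhiDeriv l η 0 x * (coulombPhiDeriv l η 1 x + x * coulombPhiDeriv l η 2 x +
        H * coulombPhiDeriv l η 1 x) := by
    intro x
    have hL := laguerre_inequality_of_coulomb_ode hl h₀ h₁ h₂ hode x
    have hE := sq_add_sq_pos_of_coulomb_ode h₀ h₁ hode hinit x
    have e : (coulombPhiDeriv l η 0 x + x * coulombPhiDeriv l η 1 x) *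
        (x * coulombPhiDeriv l η 1 x + H * coulombPhiDeriv l η 0 x) -
        x * coulombPhiDeriv l η 0 x * (coulombPhiDeriv l η 1 x + x * coulombPhiDeriv l η 2 x +
          H * coulombPhiDeriv l η 1 x) = H * coulombPhiDeriv l η 0 x ^ 2 +
        x ^ 2 * (coulombPhiDeriv l η 1 x ^ 2 -
          coulombPhiDeriv l η 0 x * coulombPhiDeriv l η 2 x) := by ring
    rw [e]
    by_cases hφ : coulombPhiDeriv l η 0 x = 0
    · have hx : x ≠ 0 := by
        rintro rfl
        exact one_ne_zero (hinit.symm.trans hφ)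
      simp only [hφ] at hE ⊢
      have : 0 < coulombPhiDeriv l η 1 x ^ 2 := by simpa using hE
      have : 0 < x ^ 2 * coulombPhiDeriv l η 1 x ^ 2 := by positivity
      simpa using this
    · have := mul_nonneg (sq_nonneg x) (sub_nonneg.2 hL)
      have : 0 < H * coulombPhiDeriv l η 0 x ^ 2 := by positivity
      linarith
  refine ⟨fun x ⟨h1, h2⟩ => ?_, fun x y hxy hx hy hne => ?_, fun x y hxy hx hy hne => ?_⟩
  · have := hW x
    rw [h1, h2] at this
    simp at this
  · exact existsUnique_zero_of_wronskian_ne_zero hF hψ (fun x => (hW x).ne') hxy hx hy hne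
  · refine existsUnique_zero_of_wronskian_ne_zero hψ hF (fun x h => (hW x).ne' ?_) hxy hx hy hne
    linarith
end

section
/- Let η ≠ 0 and ℓ > −3/2 with ℓ ≠ −1. Then the real zeros of φ_{ℓ,η} and the real zeros of φ′_{ℓ,η} strictly interlace: φ_{ℓ,η} and φ′_{ℓ,η} have no common zero, and between any two consecutive real zeros of φ_{ℓ,η} there lies exactly one real zero of φ′_{ℓ,η}, and conversely. -/
open Set Filter Topology

/-- Coefficients of the termwise derivative of a power series. -/
def derivCoeff (a : ℕ → ℝ) (k : ℕ) : ℝ := ((k : ℝ) + 1) * a (k + 1)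

theorem summable_derivCoeff {a : ℕ → ℝ} (ha : ∀ x : ℝ, Summable fun k => a k * x ^ k) (x : ℝ) :
    Summable fun k => derivCoeff a k * x ^ k := by
  have h1 : Summable fun k => ‖a (k + 1) * (2 * (|x| + 1)) ^ (k + 1)‖ :=
    ((summable_nat_add_iff 1).2 (ha (2 * (|x| + 1)))).norm
  refine Summable.of_norm_bounded h1 fun k => ?_
  have hk : ((k : ℝ) + 1) ≤ 2 ^ (k + 1) := by
    exact_mod_cast (Nat.lt_two_pow_self (n := k + 1)).le
  have hx : |x| ^ k ≤ (|x| + 1) ^ (k + 1) :=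
    calc |x| ^ k ≤ (|x| + 1) ^ k := by gcongr; linarith
      _ ≤ (|x| + 1) ^ (k + 1) :=
        pow_le_pow_right₀ (by linarith [abs_nonneg x]) (Nat.le_succ k)
  have hnn : (0 : ℝ) ≤ k + 1 := by positivity
  simp only [derivCoeff, norm_mul, norm_pow, Real.norm_eq_abs, abs_of_nonneg hnn, mul_pow,
    abs_two, abs_of_nonneg (by positivity : 0 ≤ |x| + 1)]
  calc ((k : ℝ) + 1) * |a (k + 1)| * |x| ^ k
      = |a (k + 1)| * (((k : ℝ) + 1) * |x| ^ k) := by ring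
    _ ≤ |a (k + 1)| * (2 ^ (k + 1) * (|x| + 1) ^ (k + 1)) := by gcongr

theorem hasDerivAt_tsum_pow {a : ℕ → ℝ} (ha : ∀ x : ℝ, Summable fun k => a k * x ^ k) (x : ℝ) :
    HasDerivAt (fun y => ∑' k, a k * y ^ k) (∑' k, derivCoeff a k * x ^ k) x := by
  have hs := summable_derivCoeff ha
  have hsplit : ∑' k : ℕ, a k * ((k : ℝ) * x ^ (k - 1)) = ∑' k, derivCoeff a k * x ^ k := by
    have hterm : ∀ k : ℕ, a (k + 1) * (((k + 1 : ℕ) : ℝ) * x ^ (k + 1 - 1))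
        = derivCoeff a k * x ^ k := fun k => by
      simp only [derivCoeff, Nat.add_sub_cancel]
      push_cast
      ring
    have hS : Summable fun k : ℕ => a k * ((k : ℝ) * x ^ (k - 1)) := by
      rw [← summable_nat_add_iff 1]
      simpa only [hterm] using hs x
    rw [hS.tsum_eq_zero_add]
    simp only [hterm]
    simp
  rw [← hsplit]
  have hu : Summable fun k : ℕ => |a k| * ((k : ℝ) * (|x| + 1) ^ (k - 1)) := by
    rw [← summable_nat_add_iff 1]
    refine (hs (|x| + 1)).norm.congr fun k => ?_
    have hnn : (0 : ℝ) ≤ k + 1 := by positivity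
    simp only [derivCoeff, norm_mul, norm_pow, Real.norm_eq_abs, abs_of_nonneg hnn,
      abs_of_nonneg (by positivity : 0 ≤ |x| + 1), Nat.add_sub_cancel]
    push_cast
    ring
  refine hasDerivAt_tsum_of_isPreconnected (t := Metric.ball 0 (|x| + 1)) hu Metric.isOpen_ball
    (convex_ball _ _).isPreconnected
    (fun k y _ => (hasDerivAt_pow k y).const_mul (a k)) (fun k y hy => ?_)
    (y₀ := 0) (by simp; positivity) (ha 0) (by simp)
  have hy' : |y| ≤ |x| + 1 := by simpa using (mem_ball_zero_iff.1 hy).le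
  simp only [norm_mul, norm_pow, Real.norm_eq_abs, Nat.abs_cast]
  gcongr

theorem summable_of_two_step_recurrence {a : ℕ → ℝ} {c : ℝ} {q : ℕ → ℝ}
    (hq : Tendsto q atTop atTop) (ha : ∀ k, q k * a (k + 2) = c * a (k + 1) - a k) (x : ℝ) :
    Summable fun k => a k * x ^ k := by
  set R := 2 * |x| + 1 with hR
  have hR0 : 0 < R := by positivity
  obtain ⟨N, hN⟩ := eventually_atTop.1 (hq.eventually_ge_atTop (|c| * R + R ^ 2 + 1))
  obtain ⟨C, hC0, hC⟩ : ∃ C, 0 ≤ C ∧ ∀ k, |a (k + N)| * R ^ (k + N) ≤ C ∧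
      |a (k + 1 + N)| * R ^ (k + 1 + N) ≤ C := by
    refine ⟨max (|a N| * R ^ N) (|a (1 + N)| * R ^ (1 + N)), by positivity, fun k => ?_⟩
    induction k with
    | zero => simp
    | succ k ih =>
      refine ⟨ih.2, ?_⟩
      set C := max (|a N| * R ^ N) (|a (1 + N)| * R ^ (1 + N))
      have hC0 : 0 ≤ C := le_trans (by positivity) ih.1
      have hqk := hN (k + N) (by omega)
      have hq0 : 0 < q (k + N) := lt_of_lt_of_le (by positivity) hqk
      have hrec := ha (k + N)
      have e1 : k + 1 + 1 + N = k + N + 2 := by ring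
      have e2 : k + 1 + N = k + N + 1 := by ring
      rw [e1]
      rw [e2] at ih
      have habs : q (k + N) * |a (k + N + 2)| ≤ |c| * |a (k + N + 1)| + |a (k + N)| := by
        nth_rewrite 1 [← abs_of_pos hq0]
        rw [← abs_mul, hrec, ← abs_mul]
        exact abs_sub _ _
      have : q (k + N) * (|a (k + N + 2)| * R ^ (k + N + 2)) ≤ q (k + N) * C :=
        calc q (k + N) * (|a (k + N + 2)| * R ^ (k + N + 2))
            = (q (k + N) * |a (k + N + 2)|) * R ^ (k + N + 2) := by ring
          _ ≤ (|c| * |a (k + N + 1)| + |a (k + N)|) * R ^ (k + N + 2) := by gcongr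
          _ = |c| * R * (|a (k + N + 1)| * R ^ (k + N + 1))
              + R ^ 2 * (|a (k + N)| * R ^ (k + N)) := by ring
          _ ≤ |c| * R * C + R ^ 2 * C := by gcongr; exacts [ih.2, ih.1]
          _ = (|c| * R + R ^ 2) * C := by ring
          _ ≤ q (k + N) * C := by gcongr; linarith
      exact le_of_mul_le_mul_left this hq0
  rw [← summable_nat_add_iff N]
  have hgeo : Summable fun k : ℕ => C * (1 / 2 : ℝ) ^ (k + N) :=
    ((summable_nat_add_iff N).2 summable_geometric_two).mul_left C
  refine Summable.of_norm_bounded hgeo fun k => ?_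
  have hx : |x| ≤ R * (1 / 2) := by rw [hR]; linarith
  rw [norm_mul, norm_pow, Real.norm_eq_abs, Real.norm_eq_abs]
  calc |a (k + N)| * |x| ^ (k + N) ≤ |a (k + N)| * (R * (1 / 2)) ^ (k + N) := by gcongr
    _ = |a (k + N)| * R ^ (k + N) * (1 / 2) ^ (k + N) := by rw [mul_pow]; ring
    _ ≤ C * (1 / 2) ^ (k + N) := by gcongr; exact (hC k).1

theorem coulombCoeff_recurrence {l η : ℝ} (hl : -3/2 < l) (k : ℕ) :
    (((k : ℝ) + 2) * (((k : ℝ) + 2) + 2 * l + 1)) * coulombCoeff l η (k + 2) =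
      2 * η * coulombCoeff l η (k + 1) - coulombCoeff l η k := by
  have hk : (0 : ℝ) ≤ k := k.cast_nonneg
  rw [coulombCoeff]
  exact mul_div_cancel₀ _ (mul_pos (by linarith) (by linarith)).ne'

theorem summable_coulombCoeff {l η : ℝ} (hl : -3/2 < l) (x : ℝ) :
    Summable fun k => coulombCoeff l η k * x ^ k := by
  refine summable_of_two_step_recurrence ?_ (coulombCoeff_recurrence hl) x
  refine tendsto_atTop_mono (fun k => ?_)
    ((tendsto_natCast_atTop_atTop (R := ℝ)).atTop_mul_const (by linarith : 0 < 2 * l + 3))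
  have hk : (0 : ℝ) ≤ k := k.cast_nonneg
  nlinarith [mul_nonneg hk hk]

theorem coulombPhi_ode {l η : ℝ} (hl : -3/2 < l) (hl1 : l ≠ -1) (x : ℝ) :
    x * (∑' k, derivCoeff (derivCoeff (coulombCoeff l η)) k * x ^ k)
      + (2 * l + 2) * (∑' k, derivCoeff (coulombCoeff l η) k * x ^ k)
      + (x - 2 * η) * coulombPhi l η x = 0 := by
  have h0 := summable_coulombCoeff (η := η) hl
  have h1 := summable_derivCoeff h0
  have h2 := summable_derivCoeff h1
  have shift : ∀ {a : ℕ → ℝ}, (∀ x : ℝ, Summable fun k => a k * x ^ k) →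
      (Summable fun k => a (k + 1) * x ^ k) ∧
        ∑' k, a k * x ^ k = a 0 + x * ∑' k, a (k + 1) * x ^ k := by
    intro a ha
    have hs : Summable fun k => a (k + 1) * x ^ k := by
      rcases eq_or_ne x 0 with rfl | hx
      · exact summable_of_ne_finset_zero (s := {0}) fun k hk => by
          simp only [Finset.mem_singleton] at hk
          simp [hk]
      · refine (((summable_nat_add_iff 1).2 (ha x)).mul_left x⁻¹).congr fun k => ?_
        rw [pow_succ]
        field_simp
    refine ⟨hs, ?_⟩
    rw [(ha x).tsum_eq_zero_add, ← tsum_mul_left]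
    simp only [pow_zero, mul_one]
    congr 2
    ext k
    ring
  obtain ⟨s0, e0⟩ := shift h0
  obtain ⟨s1, e1⟩ := shift h1
  have key : (∑' k, derivCoeff (derivCoeff (coulombCoeff l η)) k * x ^ k)
      + (2 * l + 2) * (∑' k, derivCoeff (coulombCoeff l η) (k + 1) * x ^ k)
      - 2 * η * (∑' k, coulombCoeff l η (k + 1) * x ^ k)
      + ∑' k, coulombCoeff l η k * x ^ k = 0 := by
    refine (((((h2 x).hasSum.add (s1.hasSum.mul_left (2 * l + 2))).sub
      (s0.hasSum.mul_left (2 * η))).add (h0 x).hasSum).unique ?_)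
    refine (congrArg (HasSum · (0 : ℝ)) (funext fun k => ?_)).mpr (hasSum_zero (β := ℕ))
    have := coulombCoeff_recurrence (η := η) hl k
    simp only [derivCoeff]
    push_cast
    linear_combination x ^ k * this
  have hc : (2 * l + 2) * derivCoeff (coulombCoeff l η) 0 = 2 * η * coulombCoeff l η 0 := by
    have : l + 1 ≠ 0 := fun h => hl1 (by linarith)
    simp only [derivCoeff, coulombCoeff]
    push_cast
    field_simp
    ring
  rw [coulombPhi]
  linear_combination x * key + hc + (2 * l + 2) * e1 - 2 * η * e0

theorem pos_of_euler_operator_nonneg {f f' : ℝ → ℝ} {p : ℝ} (hp : 0 < p)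
    (hf : ∀ x, HasDerivAt f (f' x) x) (h : ∀ x, 0 ≤ x * f' x + p * f x) (h0 : 0 < f 0)
    (x : ℝ) : 0 < f x := by
  have hfc : Continuous f := continuous_iff_continuousAt.2 fun x => (hf x).continuousAt
  have hsc : Continuous fun s : ℝ => f (s * x) := hfc.comp (continuous_id.mul continuous_const)
  have hd : ∀ s : ℝ, 0 < s → HasDerivAt (fun s : ℝ => s ^ p * f (s * x))
      (p * s ^ (p - 1) * f (s * x) + s ^ p * (f' (s * x) * x)) s := fun s hs => by
    refine (Real.hasDerivAt_rpow_const (Or.inl hs.ne')).mul ?_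
    exact (hf (s * x)).comp s (by simpa using (hasDerivAt_id s).mul_const x)
  have hmono : MonotoneOn (fun s : ℝ => s ^ p * f (s * x)) (Icc 0 1) := by
    refine monotoneOn_of_deriv_nonneg (convex_Icc 0 1)
      ((Real.continuous_rpow_const hp.le).mul hsc).continuousOn (fun s hs => ?_) fun s hs => ?_
    · rw [interior_Icc] at hs
      exact (hd s hs.1).differentiableAt.differentiableWithinAt
    · rw [interior_Icc] at hs
      have hsp : s ^ p = s ^ (p - 1) * s := by
        rw [← Real.rpow_add_one hs.1.ne', sub_add_cancel]
      rw [(hd s hs.1).deriv, hsp]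
      have := mul_nonneg (Real.rpow_pos_of_pos hs.1 (p - 1)).le (h (s * x))
      linarith
  have hnear : ∀ᶠ s in 𝓝[>] (0 : ℝ), 0 < f (s * x) :=
    (hsc.tendsto' 0 (f 0) (by simp)).eventually_const_lt h0 |>.filter_mono nhdsWithin_le_nhds
  obtain ⟨s, hfs, hs⟩ := (hnear.and (Ioo_mem_nhdsGT (zero_lt_one' ℝ))).exists
  have := hmono (Ioo_subset_Icc_self hs) (right_mem_Icc.2 zero_le_one) hs.2.le
  simp only [Real.one_rpow, one_mul] at this
  exact lt_of_lt_of_le (mul_pos (Real.rpow_pos_of_pos hs.1 p) hfs) this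

/-- The strict Laguerre inequality for a solution of `x u'' + c u' + (x - d) u = 0`, `c > -1`,
that does not vanish at the singular point `0`. -/
theorem laguerre_of_ode {u u₁ u₂ u₃ : ℝ → ℝ} {c d : ℝ} (hc : -1 < c)
    (h₀ : ∀ x, HasDerivAt u (u₁ x) x) (h₁ : ∀ x, HasDerivAt u₁ (u₂ x) x)
    (h₂ : ∀ x, HasDerivAt u₂ (u₃ x) x)
    (hode : ∀ x, x * u₂ x + c * u₁ x + (x - d) * u x = 0)
    (hne : u 0 ≠ 0) (x : ℝ) : 0 < u₁ x ^ 2 - u x * u₂ x := by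
  have hode' : ∀ x, x * u₃ x + (c + 1) * u₂ x + (x - d) * u₁ x + u x = 0 := fun x => by
    have hd := (((hasDerivAt_id x).mul (h₂ x)).add ((h₁ x).const_mul c)).add
      (((hasDerivAt_id x).sub_const d).mul (h₀ x))
    have hz : HasDerivAt (fun _ : ℝ => (0 : ℝ)) 0 x := hasDerivAt_const x 0
    have := hd.unique (hz.congr_of_eventuallyEq (Eventually.of_forall hode))
    simp only [id] at this
    linear_combination this
  have heuler : ∀ x, x * (u₁ x * u₂ x - u x * u₃ x) + (c + 1) * (u₁ x ^ 2 - u x * u₂ x)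
      = u x ^ 2 + u₁ x ^ 2 := fun x => by
    linear_combination u₁ x * hode x - u x * hode' x
  refine pos_of_euler_operator_nonneg (f := fun x => u₁ x ^ 2 - u x * u₂ x)
    (f' := fun x => u₁ x * u₂ x - u x * u₃ x) (p := c + 1) (by linarith) (fun x => ?_)
    (fun x => ?_) ?_ x
  · refine (((h₁ x).pow 2).sub ((h₀ x).mul (h₂ x))).congr_deriv ?_
    push_cast
    ring
  · rw [heuler]
    positivity
  · have h := heuler 0
    have : 0 < (c + 1) * (u₁ 0 ^ 2 - u 0 * u₂ 0) := by
      rw [zero_mul, zero_add] at h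
      rw [h]
      positivity
    exact pos_of_mul_pos_right this (by linarith)

theorem strictAntiOn_logDeriv_of_laguerre {u u₁ u₂ : ℝ → ℝ} {D : Set ℝ} (hD : Convex ℝ D)
    (h₀ : ∀ x, HasDerivAt u (u₁ x) x) (h₁ : ∀ x, HasDerivAt u₁ (u₂ x) x)
    (hW : ∀ x, 0 < u₁ x ^ 2 - u x * u₂ x) (hne : ∀ x ∈ D, u x ≠ 0) :
    StrictAntiOn (fun x => u₁ x / u x) D := by
  have hd : ∀ x ∈ D, HasDerivAt (fun x => u₁ x / u x)
      ((u₂ x * u x - u₁ x * u₁ x) / u x ^ 2) x := fun x hx => (h₁ x).div (h₀ x) (hne x hx)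
  refine strictAntiOn_of_deriv_neg hD
    (fun x hx => (hd x hx).continuousAt.continuousWithinAt) fun x hx => ?_
  have hx := interior_subset hx
  rw [(hd x hx).deriv]
  have := hne x hx
  exact div_neg_of_neg_of_pos (by linarith [hW x]) (by positivity)

/-- The strict Laguerre inequality forces the zeros of `u` and `u'` to interlace. -/
theorem interlacing_of_laguerre {u u₁ u₂ : ℝ → ℝ}
    (h₀ : ∀ x, HasDerivAt u (u₁ x) x) (h₁ : ∀ x, HasDerivAt u₁ (u₂ x) x)
    (hW : ∀ x, 0 < u₁ x ^ 2 - u x * u₂ x) :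
    (∀ x : ℝ, ¬(u x = 0 ∧ u₁ x = 0)) ∧
      (∀ x y : ℝ, x < y → u x = 0 → u y = 0 → (∀ t ∈ Ioo x y, u t ≠ 0) →
        ∃! t : ℝ, t ∈ Ioo x y ∧ u₁ t = 0) ∧
      ∀ x y : ℝ, x < y → u₁ x = 0 → u₁ y = 0 → (∀ t ∈ Ioo x y, u₁ t ≠ 0) →
        ∃! t : ℝ, t ∈ Ioo x y ∧ u t = 0 := by
  have hcommon : ∀ x : ℝ, ¬(u x = 0 ∧ u₁ x = 0) := fun x ⟨hx, hx'⟩ => by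
    have := hW x
    simp [hx, hx'] at this
  have hcont : Continuous u := continuous_iff_continuousAt.2 fun x => (h₀ x).continuousAt
  have rolle : ∀ x y : ℝ, x < y → u x = 0 → u y = 0 → ∃ t ∈ Ioo x y, u₁ t = 0 :=
    fun x y hxy hx hy => exists_hasDerivAt_eq_zero hxy hcont.continuousOn (hx.trans hy.symm)
      fun t _ => h₀ t
  refine ⟨hcommon, fun x y hxy hx hy hne => ?_, fun x y hxy hx hy hne => ?_⟩
  · obtain ⟨t, ht, ht0⟩ := rolle x y hxy hx hy
    refine ⟨t, ⟨ht, ht0⟩, fun s ⟨hs, hs0⟩ => ?_⟩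
    exact (strictAntiOn_logDeriv_of_laguerre (convex_Ioo x y) h₀ h₁ hW hne).injOn hs ht
      (by simp [hs0, ht0])
  · have hex : ∃ t ∈ Ioo x y, u t = 0 := by
      by_contra! hno
      have hno' : ∀ t ∈ Icc x y, u t ≠ 0 := fun t ht h0 => by
        rcases eq_endpoints_or_mem_Ioo_of_mem_Icc ht with rfl | rfl | h
        · exact hcommon _ ⟨h0, hx⟩
        · exact hcommon _ ⟨h0, hy⟩
        · exact hno t h h0
      refine hxy.ne ((strictAntiOn_logDeriv_of_laguerre (convex_Icc x y) h₀ h₁ hW hno').injOn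
        (left_mem_Icc.2 hxy.le) (right_mem_Icc.2 hxy.le) (by simp [hx, hy]))
    obtain ⟨t, ht, ht0⟩ := hex
    have hlt : ∀ a ∈ Ioo x y, ∀ b ∈ Ioo x y, u a = 0 → u b = 0 → ¬a < b :=
      fun a ha b hb ha0 hb0 hab => by
        obtain ⟨r, hr, hr0⟩ := rolle a b hab ha0 hb0
        exact hne r ⟨ha.1.trans hr.1, hr.2.trans hb.2⟩ hr0
    exact ⟨t, ⟨ht, ht0⟩, fun s ⟨hs, hs0⟩ =>
      le_antisymm (not_lt.1 (hlt t ht s hs ht0 hs0)) (not_lt.1 (hlt s hs t ht hs0 ht0))⟩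


/-- Theorem 5.3 (ii): the real zeros of φ_{ℓ,η} and of φ'_{ℓ,η} strictly interlace:
no common zero, and between any two consecutive real zeros of either function lies
exactly one real zero of the other. -/
theorem stmt_17 (l η : ℝ) (hl : -3/2 < l) (hl1 : l ≠ -1) (hη : η ≠ 0) :
    (∀ x : ℝ, ¬(coulombPhi l η x = 0 ∧ deriv (coulombPhi l η) x = 0)) ∧
      (∀ x y : ℝ, x < y → coulombPhi l η x = 0 → coulombPhi l η y = 0 →
        (∀ t ∈ Set.Ioo x y, coulombPhi l η t ≠ 0) →
        ∃! t : ℝ, t ∈ Set.Ioo x y ∧ deriv (coulombPhi l η) t = 0) ∧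
      ∀ x y : ℝ, x < y → deriv (coulombPhi l η) x = 0 → deriv (coulombPhi l η) y = 0 →
        (∀ t ∈ Set.Ioo x y, deriv (coulombPhi l η) t ≠ 0) →
        ∃! t : ℝ, t ∈ Set.Ioo x y ∧ coulombPhi l η t = 0 := by
  have s₀ := summable_coulombCoeff (η := η) hl
  have s₁ := summable_derivCoeff s₀
  have s₂ := summable_derivCoeff s₁
  have h₀ : ∀ x, HasDerivAt (coulombPhi l η)
      (∑' k, derivCoeff (coulombCoeff l η) k * x ^ k) x := hasDerivAt_tsum_pow s₀
  have hderiv : deriv (coulombPhi l η) = fun x => ∑' k, derivCoeff (coulombCoeff l η) k * x ^ k :=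
    funext fun x => (h₀ x).deriv
  have hzero : coulombPhi l η 0 ≠ 0 := by
    have : coulombPhi l η 0 = 1 := by
      rw [coulombPhi, tsum_eq_single 0 fun k hk => by simp [hk]]
      simp [coulombCoeff]
    simp [this]
  rw [hderiv]
  exact interlacing_of_laguerre h₀ (hasDerivAt_tsum_pow s₁)
    (laguerre_of_ode (c := 2 * l + 2) (d := 2 * η) (by linarith) h₀ (hasDerivAt_tsum_pow s₁)
      (hasDerivAt_tsum_pow s₂) (coulombPhi_ode hl hl1) hzero)
end
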